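/- arXiv:1308.3223 — 2 statements merged into one kernel-verified Lean document; each statement's English description precedes it below -/
import Mathlib

section
/- Let (A,d,ω) be a dg symplectic space and C a finite set with distinct elements a,b,c,d ∉ C adjoined. Then the contractions of the endomorphism operad anticommute: ξ_{ab} ∘ ξ_{cd} = − ξ_{cd} ∘ ξ_{ab} as maps End_A(C⊔{a,b,c,d},G) → End_A(C,G+2). -/
open Finset

noncomputable section

namespace Paper

variable (k : Type) [Field k]

/-- `msign m = (−1)^m`. -/
def msign (m : ℤ) : k := if Odd m then -1 else 1

/-- The Koszul sign of the action of a permutation `τ` on a tensor product of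
homogeneous factors of degrees `d i`. -/
def koszulSign {n : ℕ} (d : Fin n → ℤ) (τ : Equiv.Perm (Fin n)) : k :=
  ∏ i : Fin n, ∏ j : Fin n,
    if i < j ∧ τ j < τ i ∧ Odd (d i) ∧ Odd (d j) then (-1 : k) else (1 : k)

variable (ι : Type) [Fintype ι] [DecidableEq ι]

/-- The `n`-th tensor power `A^{⊗n}` of the graded vector space `A` with
homogeneous basis indexed by `ι`, in coordinates. -/
abbrev TPow (n : ℕ) : Type := (Fin n → ι) →₀ k

variable (deg : ι → ℤ)

/-- The Koszul-signed action of `τ ∈ Σ_n` on `A^{⊗n}`. -/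
def permAct {n : ℕ} (τ : Equiv.Perm (Fin n)) : TPow k ι n →ₗ[k] TPow k ι n :=
  Finsupp.lift (TPow k ι n) k (Fin n → ι)
    (fun I => koszulSign k (fun p => deg (I p)) τ • Finsupp.single (I ∘ τ.symm) (1 : k))

variable (S : Finset ℕ)

/-- The direct sum `⊕_{ψ : C ≃ [n]} A^{⊗n}` over all bijections `ψ`. -/
abbrev PreT : Type := ((↥S ≃ Fin S.card) × (Fin S.card → ι)) →₀ k

/-- The inclusion `i_ψ` of the `ψ`-th summand. -/
def iPre (ψ : ↥S ≃ Fin S.card) : TPow k ι S.card →ₗ[k] PreT k ι S :=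
  Finsupp.lift (PreT k ι S) k (Fin S.card → ι) (fun I => Finsupp.single (ψ, I) (1 : k))

/-- The submodule of relations `i_ψ(v) ∼ i_{τψ}(τ(v))`. -/
def tensRel : Submodule k (PreT k ι S) :=
  Submodule.span k
    {x | ∃ (ψ : ↥S ≃ Fin S.card) (τ : Equiv.Perm (Fin S.card)) (v : TPow k ι S.card),
      x = iPre k ι S ψ v - iPre k ι S (ψ.trans τ) (permAct k ι deg τ v)}

/-- The unordered tensor product `⊗_C A := (⊕_ψ A^{⊗n})/∼`. -/
abbrev TensC : Type := PreT k ι S ⧸ tensRel k ι deg S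

/-- The structure map `ι_ψ : A^{⊗n} → ⊗_C A`. -/
def iota (ψ : ↥S ≃ Fin S.card) : TPow k ι S.card →ₗ[k] TensC k ι deg S :=
  (tensRel k ι deg S).mkQ.comp (iPre k ι S ψ)

/-- A dg symplectic space over `k`, presented by a homogeneous basis `{a_i}_{i : ι}`. -/
structure SympData where
  deg : ι → ℤ
  dm : Matrix ι ι k
  ω : Matrix ι ι k
  even_dim : Even (Fintype.card ι)
  dm_homog : ∀ i j, dm j i ≠ 0 → deg j = deg i + 1
  dm_sq : dm * dm = 0
  ω_homog : ∀ i j, ω i j ≠ 0 → deg i + deg j = 1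
  ω_antisymm : ∀ i j, ω i j = - (msign k (deg i * deg j) * ω j i)
  ω_unit : IsUnit ω
  ω_d : ∀ i j, (∑ l, dm l i * ω l j) + msign k (deg i) * (∑ l, dm l j * ω i l) = 0

variable {k ι}

/-- Coefficient matrix of `Σ_i a'_i ⊗ b'_i` for a basis with degrees `deg'` and
form matrix `ω'`; `b'_i := Σ_j (−1)^{|a'_j|} (ω'⁻¹)_{ij} a'_j`. -/
def binvOf (deg' : ι → ℤ) (ω' : Matrix ι ι k) : Matrix ι ι k :=
  fun i j => msign k (deg' j) * ω'⁻¹ i j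

/-- Coefficients of `b_i` in the given basis: `binv i j` is the coefficient of `a_j` in `b_i`. -/
def SympData.binv (A : SympData k ι) : Matrix ι ι k := binvOf A.deg A.ω

variable (A : SympData k ι)

/-- The endomorphism operad component `End_A(C,G) := Hom(⊗_C A, k)`
(the genus `G` only enters through stability). -/
abbrev EndS (S : Finset ℕ) : Type := TensC k ι A.deg S →ₗ[k] k

/-- `f` is homogeneous of degree `m` (as a functional on the graded space `⊗_C A`). -/
def IsHomogEnd {S : Finset ℕ} (f : EndS A S) (m : ℤ) : Prop :=
  ∀ (ψ : ↥S ≃ Fin S.card) (I : Fin S.card → ι),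
    f (iota k ι A.deg S ψ (Finsupp.single I 1)) ≠ 0 → (∑ p, A.deg (I p)) + m = 0

/-- The defining property of the composition `∘_{a,b}(f⊗g)` of the twisted
endomorphism operad, relative to an arbitrary homogeneous basis `{a'_i = Σ_p P p i a_p}`
with degrees `deg'`:  for every `ψ : C₁⊔C₂ ≅ [n]` with `ψ(C₁) = [|C₁|]`
(and the induced `ψ₁ : C₁⊔{a} ≅ [|C₁|+1]`, `ψ₂ : C₂⊔{b} ≅ [|C₂|+1]`),
`h∘ι_ψ = Σ_i (−1)^{|f|+|g||b'_i|} μ∘((f∘ι_{ψ₁})(a'_i⊗id^{⊗|C₁|}) ⊗ (g∘ι_{ψ₂})(b'_i⊗id^{⊗|C₂|}))`,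
where the tensor product of the two graded functionals is evaluated with the Koszul sign. -/
def CompPropWith (P : Matrix ι ι k) (deg' : ι → ℤ)
    (a b : ℕ) (C₁ C₂ S₁ S₂ D : Finset ℕ) (df dg : ℤ)
    (f : EndS A S₁) (g : EndS A S₂) (h : EndS A D) : Prop :=
  ∀ (ψ : ↥D ≃ Fin D.card) (ψ₁ : ↥S₁ ≃ Fin S₁.card) (ψ₂ : ↥S₂ ≃ Fin S₂.card),
    (∀ x : ↥D, (x : ℕ) ∈ C₁ → (ψ x : ℕ) < C₁.card) →
    (∀ x : ↥S₁, ((x : ℕ) = a ↔ (ψ₁ x : ℕ) = 0)) →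
    (∀ (x : ↥S₁) (hx : (x : ℕ) ∈ D), (x : ℕ) ∈ C₁ → (ψ₁ x : ℕ) = (ψ ⟨x, hx⟩ : ℕ) + 1) →
    (∀ x : ↥S₂, ((x : ℕ) = b ↔ (ψ₂ x : ℕ) = 0)) →
    (∀ (x : ↥S₂) (hx : (x : ℕ) ∈ D), (x : ℕ) ∈ C₂ → (ψ₂ x : ℕ) + C₁.card = (ψ ⟨x, hx⟩ : ℕ) + 1) →
    ∀ I : Fin D.card → ι,
      h (iota k ι A.deg D ψ (Finsupp.single I 1)) =
        ∑ i : ι, ∑ j : ι,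
          msign k (df + dg * (1 - deg' i) +
              (dg + 1 - deg' i) * (∑ x : ↥D, if (x : ℕ) ∈ C₁ then A.deg (I (ψ x)) else 0)) *
            binvOf deg' (P.transpose * A.ω * P) i j *
            (∑ p : ι, P p i *
              f (iota k ι A.deg S₁ ψ₁ (Finsupp.single
                (fun r => if hx : ((ψ₁.symm r : ℕ) ∈ D) ∧ ((ψ₁.symm r : ℕ) ∈ C₁)
                  then I (ψ ⟨(ψ₁.symm r : ℕ), hx.1⟩) else p) 1))) *
            (∑ q : ι, P q j *
              g (iota k ι A.deg S₂ ψ₂ (Finsupp.single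
                (fun r => if hx : ((ψ₂.symm r : ℕ) ∈ D) ∧ ((ψ₂.symm r : ℕ) ∈ C₂)
                  then I (ψ ⟨(ψ₂.symm r : ℕ), hx.1⟩) else q) 1)))

/-- The defining property of `∘_{a,b}(f⊗g)` in the standard basis. -/
def CompProp (a b : ℕ) (C₁ C₂ S₁ S₂ D : Finset ℕ) (df dg : ℤ)
    (f : EndS A S₁) (g : EndS A S₂) (h : EndS A D) : Prop :=
  CompPropWith A 1 A.deg a b C₁ C₂ S₁ S₂ D df dg f g h

/-- The composition `∘_{a,b}(f⊗g)` of the twisted endomorphism operad, defined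
as the element satisfying its defining property (it exists and is unique). -/
def compEl (a b : ℕ) (C₁ C₂ S₁ S₂ D : Finset ℕ) (df dg : ℤ)
    (f : EndS A S₁) (g : EndS A S₂) : EndS A D :=
  @Classical.epsilon _ ⟨0⟩ (CompProp A a b C₁ C₂ S₁ S₂ D df dg f g)

/-- The defining property of the contraction `ξ_{ab}(f)` of the twisted
endomorphism operad:  for every `ψ : C ≅ [|C|]` and the induced
`ψ' : C⊔{a,b} ≅ [|C|+2]` (`ψ'(a) = 1`, `ψ'(b) = 2`, `ψ'(c) = ψ(c)+2`),
`h∘ι_ψ = (−1)^{|f|} Σ_i (f∘ι_{ψ'})(a_i⊗b_i⊗id^{⊗|C|})`. -/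
def XiProp (a b : ℕ) (Ssrc C : Finset ℕ) (df : ℤ)
    (f : EndS A Ssrc) (h : EndS A C) : Prop :=
  ∀ (ψ : ↥C ≃ Fin C.card) (ψ' : ↥Ssrc ≃ Fin Ssrc.card),
    (∀ x : ↥Ssrc, ((x : ℕ) = a ↔ (ψ' x : ℕ) = 0)) →
    (∀ x : ↥Ssrc, ((x : ℕ) = b ↔ (ψ' x : ℕ) = 1)) →
    (∀ (x : ↥Ssrc) (hx : (x : ℕ) ∈ C), (ψ' x : ℕ) = (ψ ⟨x, hx⟩ : ℕ) + 2) →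
    ∀ I : Fin C.card → ι,
      h (iota k ι A.deg C ψ (Finsupp.single I 1)) =
        msign k df * ∑ i : ι, ∑ j : ι,
          A.binv i j *
            f (iota k ι A.deg Ssrc ψ' (Finsupp.single
              (fun r => if hx : ((ψ'.symm r : ℕ) ∈ C)
                then I (ψ ⟨(ψ'.symm r : ℕ), hx⟩)
                else if (ψ'.symm r : ℕ) = a then i else j) 1))

/-- The contraction `ξ_{ab}(f)` of the twisted endomorphism operad. -/
def xiEl (a b : ℕ) (Ssrc C : Finset ℕ) (df : ℤ) (f : EndS A Ssrc) : EndS A C :=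
  @Classical.epsilon _ ⟨0⟩ (XiProp A a b Ssrc C df f)

/-- The defining property of the differential on `End_A(C,G)`:
`d(f)∘ι_ψ = (−1)^{|f|} Σ_{i=0}^{n−1} (f∘ι_ψ)(id^{⊗i}⊗d⊗id^{⊗(n−i−1)})`,
tensor products of graded maps being evaluated with Koszul signs. -/
def DiffProp (S : Finset ℕ) (df : ℤ) (f h : EndS A S) : Prop :=
  ∀ (ψ : ↥S ≃ Fin S.card) (I : Fin S.card → ι),
    h (iota k ι A.deg S ψ (Finsupp.single I 1)) =
      msign k df * ∑ p : Fin S.card,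
        msign k (∑ q : Fin S.card, if (q : ℕ) < (p : ℕ) then A.deg (I q) else 0) *
          ∑ j : ι, A.dm j (I p) *
            f (iota k ι A.deg S ψ (Finsupp.single (Function.update I p j) 1))

/-- The differential of the twisted endomorphism operad, on homogeneous
elements of degree `df`. -/
def dEl (S : Finset ℕ) (df : ℤ) (f : EndS A S) : EndS A S :=
  @Classical.epsilon _ ⟨0⟩ (DiffProp A S df f)

/-- The defining property of the relabeling map `End_A(ρ) : End_A(C,G) → End_A(D,G)`
for a bijection `ρ : C ≅ D`:  `End_A(ρ)(f)∘ι_ψ = f∘ι_{ψρ}`. -/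
def RelabelProp (ρ : ℕ → ℕ) (C D : Finset ℕ) (f : EndS A C) (h : EndS A D) : Prop :=
  ∀ (hρ : ∀ x : ↥C, ρ x ∈ D) (ψD : ↥D ≃ Fin D.card) (ψC : ↥C ≃ Fin C.card),
    (∀ x : ↥C, (ψC x : ℕ) = (ψD ⟨ρ x, hρ x⟩ : ℕ)) →
    ∀ I : Fin D.card → ι,
      h (iota k ι A.deg D ψD (Finsupp.single I 1)) =
        f (iota k ι A.deg C ψC (Finsupp.single
          (fun p => I (ψD ⟨ρ (ψC.symm p), hρ _⟩)) 1))

/-- The relabeling map `End_A(ρ)` of the endomorphism operad. -/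
def relabelEnd (ρ : ℕ → ℕ) (C D : Finset ℕ) (f : EndS A C) : EndS A D :=
  @Classical.epsilon _ ⟨0⟩ (RelabelProp A ρ C D f)

/-- Stability of the corolla `(C,G)` : `2(G−1)+|C| > 0`. -/
def StableCorolla (C : Finset ℕ) (G : ℕ) : Prop := 2 < 2 * G + C.card

end Paper

namespace Paper

section Helpers

variable {k : Type} [Field k] {ι : Type} [Fintype ι] [DecidableEq ι]

/-- Koszul sign between two orderings, as a product over the label set. -/
def KS (k : Type) [Field k] {S : Finset ℕ} (d : ↥S → ℤ) (ψ ψ' : ↥S ≃ Fin S.card) : k :=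
  ∏ u : ↥S, ∏ v : ↥S,
    if ψ u < ψ v ∧ ψ' v < ψ' u ∧ Odd (d u) ∧ Odd (d v) then (-1 : k) else (1 : k)

lemma koszul_eq_KS {S : Finset ℕ} (d : ↥S → ℤ) (ψ ψ' : ↥S ≃ Fin S.card) :
    koszulSign k (fun p => d (ψ.symm p)) (ψ.symm.trans ψ') = KS k d ψ ψ' := by
  unfold koszulSign KS
  rw [← Equiv.prod_comp ψ]
  refine Finset.prod_congr rfl fun u _ => ?_
  rw [← Equiv.prod_comp ψ]
  refine Finset.prod_congr rfl fun v _ => ?_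
  simp

lemma iota_single (deg : ι → ℤ) {S : Finset ℕ} (ψ ψ' : ↥S ≃ Fin S.card) (x : ↥S → ι) :
    iota k ι deg S ψ (Finsupp.single (x ∘ ψ.symm) 1) =
      KS k (fun u => deg (x u)) ψ ψ' • iota k ι deg S ψ' (Finsupp.single (x ∘ ψ'.symm) 1) := by
  have h : iPre k ι S ψ (Finsupp.single (x ∘ ψ.symm) 1) -
      iPre k ι S (ψ.trans (ψ.symm.trans ψ'))
        (permAct k ι deg (ψ.symm.trans ψ') (Finsupp.single (x ∘ ψ.symm) 1)) ∈ tensRel k ι deg S :=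
    Submodule.subset_span ⟨_, _, _, rfl⟩
  have h2 := (Submodule.Quotient.eq _).2 h
  have h3 : permAct k ι deg (ψ.symm.trans ψ') (Finsupp.single (x ∘ ψ.symm) 1) =
      KS k (fun u => deg (x u)) ψ ψ' • Finsupp.single (x ∘ ψ'.symm) 1 := by
    rw [← koszul_eq_KS]
    simp only [permAct, Finsupp.lift_apply]
    rw [Finsupp.sum_single_index (by simp), one_smul]
    congr 2
    funext r
    simp
  have h4 : ψ.trans (ψ.symm.trans ψ') = ψ' := by ext; simp
  rw [h3, h4, map_smul] at h2
  exact h2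

lemma end_single (A : SympData k ι) {S : Finset ℕ} (f : EndS A S)
    (ψ ψ' : ↥S ≃ Fin S.card) (x : ↥S → ι) :
    f (iota k ι A.deg S ψ (Finsupp.single (x ∘ ψ.symm) 1)) =
      KS k (fun u => A.deg (x u)) ψ ψ' *
        f (iota k ι A.deg S ψ' (Finsupp.single (x ∘ ψ'.symm) 1)) := by
  rw [iota_single A.deg ψ ψ' x, map_smul, smul_eq_mul]

lemma end_ext (A : SympData k ι) {S : Finset ℕ} (f g : EndS A S)
    (h : ∀ ψ I, f (iota k ι A.deg S ψ (Finsupp.single I 1)) =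
      g (iota k ι A.deg S ψ (Finsupp.single I 1))) : f = g := by
  apply Submodule.linearMap_qext
  apply Finsupp.lhom_ext'
  rintro ⟨ψ, I⟩
  ext
  have := h ψ I
  simpa [iota, iPre] using this

/-- `ψ'` extends `ψ` by putting `a`, `b` first. -/
def IsExt (a b : ℕ) (S C : Finset ℕ) (ψ : ↥C ≃ Fin C.card) (ψ' : ↥S ≃ Fin S.card) : Prop :=
    (∀ x : ↥S, ((x : ℕ) = a ↔ (ψ' x : ℕ) = 0)) ∧
    (∀ x : ↥S, ((x : ℕ) = b ↔ (ψ' x : ℕ) = 1)) ∧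
    (∀ (x : ↥S) (hx : (x : ℕ) ∈ C), (ψ' x : ℕ) = (ψ ⟨x, hx⟩ : ℕ) + 2)

lemma exists_ext {a b : ℕ} {S C : Finset ℕ} (hab : a ≠ b) (ha : a ∉ C) (hb : b ∉ C)
    (hS : ∀ x, x ∈ S ↔ x = a ∨ x = b ∨ x ∈ C) (ψ : ↥C ≃ Fin C.card) :
    ∃ ψ', IsExt a b S C ψ ψ' := by
  have hc : S.card = C.card + 2 := by
    have : S = insert a (insert b C) := by ext x; simp [hS]
    rw [this, Finset.card_insert_of_notMem (by simp [hab, ha]), Finset.card_insert_of_notMem hb]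
  let g : ↥S → Fin S.card := fun x =>
    if hx : (x : ℕ) ∈ C then ⟨(ψ ⟨x, hx⟩ : ℕ) + 2, by have := (ψ ⟨x, hx⟩).2; omega⟩
    else if (x : ℕ) = a then ⟨0, by omega⟩ else ⟨1, by omega⟩
  have hg : Function.Injective g := by
    rintro ⟨x, hx⟩ ⟨y, hy⟩ h
    have hx' := (hS x).1 hx
    have hy' := (hS y).1 hy
    simp only [g] at h
    by_cases h1 : x ∈ C <;> by_cases h2 : y ∈ C
    · simp only [h1, h2, dif_pos, Fin.mk.injEq, add_left_inj] at h
      have := ψ.injective (Fin.ext h)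
      simpa using this
    · simp only [h1, h2, dif_pos, dif_neg, not_false_iff] at h
      split_ifs at h <;> simp at h
    · simp only [h1, h2, dif_pos, dif_neg, not_false_iff] at h
      split_ifs at h <;> simp at h
    · simp only [h1, h2, dif_neg, not_false_iff] at h
      ext
      simp only
      split_ifs at h <;> simp at h <;> grind
  have hbij : Function.Bijective g :=
    (Fintype.bijective_iff_injective_and_card g).2 ⟨hg, by simp⟩
  refine ⟨Equiv.ofBijective g hbij, ?_, ?_, ?_⟩
  · rintro ⟨x, hx⟩
    have hx' := (hS x).1 hx
    simp only [Equiv.ofBijective_apply, g]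
    split_ifs <;> simp <;> grind
  · rintro ⟨x, hx⟩
    have hx' := (hS x).1 hx
    simp only [Equiv.ofBijective_apply, g]
    split_ifs <;> simp <;> grind
  · rintro ⟨x, hx⟩ h
    simp only at h
    simp [g, h]

/-- Extension of a coloring. -/
def xExt (a : ℕ) (S C : Finset ℕ) (x : ↥C → ι) (i j : ι) : ↥S → ι := fun u =>
  if hx : (u : ℕ) ∈ C then x ⟨u, hx⟩ else if (u : ℕ) = a then i else j

lemma KS_ext {a b : ℕ} {S C : Finset ℕ} (ha : a ∉ C) (hb : b ∉ C)
    (hS : ∀ x, x ∈ S ↔ x = a ∨ x = b ∨ x ∈ C) {ψ φ : ↥C ≃ Fin C.card}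
    {ψ' φ' : ↥S ≃ Fin S.card} (hψ : IsExt a b S C ψ ψ') (hφ : IsExt a b S C φ φ')
    (d : ↥C → ℤ) (d' : ↥S → ℤ) (hd : ∀ (u : ↥S) (hu : (u : ℕ) ∈ C), d' u = d ⟨u, hu⟩) :
    KS k d' ψ' φ' = KS k d ψ φ := by
  have hCS : ∀ u ∈ C, u ∈ S := fun u hu => (hS u).2 (Or.inr (Or.inr hu))
  let e : ↥C → ↥S := fun u => ⟨u, hCS u u.2⟩
  have he : Function.Injective e := by
    intro u v h
    exact Subtype.ext (congrArg (fun z : ↥S => (z : ℕ)) h)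
  have hr : ∀ u : ↥S, u ∉ Set.range e → (u : ℕ) = a ∨ (u : ℕ) = b := by
    intro u hu
    rcases (hS u).1 u.2 with h | h | h
    · exact Or.inl h
    · exact Or.inr h
    · exact absurd ⟨⟨u, h⟩, by simp [e]⟩ hu
  have key : ∀ u v : ↥S, u ∉ Set.range e ∨ v ∉ Set.range e →
      ¬ (ψ' u < ψ' v ∧ φ' v < φ' u ∧ Odd (d' u) ∧ Odd (d' v)) := by
    rintro u v h ⟨h1, h2, -, -⟩
    rw [Fin.lt_def] at h1 h2
    obtain ⟨p1, p2, p3⟩ := hψ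
    obtain ⟨q1, q2, q3⟩ := hφ
    have a1 := p1 u
    have a2 := p1 v
    have a3 := p2 u
    have a4 := p2 v
    have b1 := q1 u
    have b2 := q1 v
    have b3 := q2 u
    have b4 := q2 v
    rcases h with h | h
    · have := hr u h
      omega
    · have := hr v h
      omega
  unfold KS
  symm
  refine Fintype.prod_of_injective e he _ _ ?_ ?_
  · intro u hu
    refine Finset.prod_eq_one fun v _ => if_neg (key u v (Or.inl hu))
  · intro u
    refine Fintype.prod_of_injective e he _ _ ?_ ?_
    · intro v hv
      exact if_neg (key _ v (Or.inr hv))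
    · intro v
      have e1 := hψ.2.2 (e u) u.2
      have e2 := hψ.2.2 (e v) v.2
      have e3 := hφ.2.2 (e u) u.2
      have e4 := hφ.2.2 (e v) v.2
      have e5 := hd (e u) u.2
      have e6 := hd (e v) v.2
      simp only [Fin.lt_def, e1, e2, e3, e4, e5, e6]
      simp [e]

lemma xi_exists (A : SympData k ι) {a b : ℕ} {S C : Finset ℕ} (hab : a ≠ b)
    (ha : a ∉ C) (hb : b ∉ C) (hS : ∀ x, x ∈ S ↔ x = a ∨ x = b ∨ x ∈ C) (df : ℤ)
    (f : EndS A S) : ∃ h, XiProp A a b S C df f h := by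
  choose E hE using exists_ext hab ha hb hS
  let val : ((↥C ≃ Fin C.card) × (Fin C.card → ι)) → k := fun q =>
    msign k df * ∑ i : ι, ∑ j : ι, A.binv i j *
      f (iota k ι A.deg S (E q.1) (Finsupp.single (xExt a S C (q.2 ∘ q.1) i j ∘ (E q.1).symm) 1))
  let H : PreT k ι C →ₗ[k] k := Finsupp.lift k k _ val
  have hH : ∀ q, H (Finsupp.single q 1) = val q := by
    intro q; simp [H]
  have hi : ∀ ψ I, iPre k ι C ψ (Finsupp.single I 1) = Finsupp.single (ψ, I) 1 := by
    intro ψ I; simp [iPre]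
  have hker : tensRel k ι A.deg C ≤ LinearMap.ker H := by
    refine Submodule.span_le.2 ?_
    rintro _ ⟨ψ, τ, v, rfl⟩
    simp only [SetLike.mem_coe, LinearMap.mem_ker, map_sub, sub_eq_zero]
    have : H.comp (iPre k ι C ψ) =
        (H.comp (iPre k ι C (ψ.trans τ))).comp (permAct k ι A.deg τ) := by
      apply Finsupp.lhom_ext'
      intro I
      ext
      simp only [LinearMap.comp_apply, Finsupp.lsingle_apply]
      have hp : permAct k ι A.deg τ (Finsupp.single I 1) =
          koszulSign k (fun p => A.deg (I p)) τ • Finsupp.single (I ∘ τ.symm) (1 : k) := by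
        simp only [permAct, Finsupp.lift_apply]
        rw [Finsupp.sum_single_index (by simp), one_smul]
      rw [hp, map_smul, map_smul, hi, hi, hH, hH, smul_eq_mul]
      have hk : koszulSign k (fun p => A.deg (I p)) τ =
          KS k (fun u => A.deg (I (ψ u))) ψ (ψ.trans τ) := by
        rw [← koszul_eq_KS]
        congr 1
        · funext p; simp
        · ext; simp
      have hx : (I ∘ τ.symm) ∘ (ψ.trans τ) = I ∘ ψ := by funext p; simp
      simp only [val]
      rw [hx, mul_left_comm]
      congr 1
      rw [Finset.mul_sum]
      refine Finset.sum_congr rfl fun i _ => ?_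
      rw [Finset.mul_sum]
      refine Finset.sum_congr rfl fun j _ => ?_
      rw [mul_left_comm, end_single A f (E ψ) (E (ψ.trans τ)), hk]
      rw [KS_ext ha hb hS (hE ψ) (hE (ψ.trans τ)) (fun u => A.deg (I (ψ u)))]
      intro u hu
      simp [xExt, hu]
    exact LinearMap.congr_fun this v
  refine ⟨(tensRel k ι A.deg C).liftQ H hker, ?_⟩
  intro ψ ψ' h1 h2 h3 I
  have hψ : ψ' = E ψ := by
    obtain ⟨g1, g2, g3⟩ := hE ψ
    ext u
    rcases (hS u).1 u.2 with h | h | h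
    · rw [(h1 u).1 h, (g1 u).1 h]
    · rw [(h2 u).1 h, (g2 u).1 h]
    · rw [h3 u h, g3 u h]
  subst hψ
  simp only [iota, LinearMap.comp_apply, Submodule.mkQ_apply, Submodule.liftQ_apply]
  rw [hi, hH]
  rfl

lemma xi_spec (A : SympData k ι) {a b : ℕ} {S C : Finset ℕ} (hab : a ≠ b)
    (ha : a ∉ C) (hb : b ∉ C) (hS : ∀ x, x ∈ S ↔ x = a ∨ x = b ∨ x ∈ C) (df : ℤ)
    (f : EndS A S) {ψ : ↥C ≃ Fin C.card} {ψ' : ↥S ≃ Fin S.card} (hψ : IsExt a b S C ψ ψ')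
    (x : ↥C → ι) :
    xiEl A a b S C df f (iota k ι A.deg C ψ (Finsupp.single (x ∘ ψ.symm) 1)) =
      msign k df * ∑ i : ι, ∑ j : ι, A.binv i j *
        f (iota k ι A.deg S ψ' (Finsupp.single (xExt a S C x i j ∘ ψ'.symm) 1)) := by
  have h := Classical.epsilon_spec (xi_exists A hab ha hb hS df f) ψ ψ' hψ.1 hψ.2.1 hψ.2.2
    (x ∘ ψ.symm)
  refine h.trans ?_
  simp only [Function.comp_apply, Equiv.symm_apply_apply]
  rfl

lemma binv_homog (A : SympData k ι) (i j : ι) (h : A.binv i j ≠ 0) :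
    A.deg i + A.deg j = 1 := by
  have hdet : IsUnit A.ω.det := (Matrix.isUnit_iff_isUnit_det _).1 A.ω_unit
  let Q : Matrix ι ι k := fun i j => if A.deg i + A.deg j = 1 then A.ω⁻¹ i j else 0
  have hQ : A.ω * Q = 1 := by
    ext p q
    rw [Matrix.mul_apply]
    by_cases hpq : A.deg p = A.deg q
    · rw [← Matrix.mul_nonsing_inv _ hdet, Matrix.mul_apply]
      refine Finset.sum_congr rfl fun l _ => ?_
      by_cases h0 : A.ω p l = 0
      · simp [h0]
      · have := A.ω_homog p l h0
        simp only [Q]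
        rw [if_pos (by omega)]
    · rw [Matrix.one_apply_ne (fun e => hpq (by rw [e]))]
      refine Finset.sum_eq_zero fun l _ => ?_
      by_cases h0 : A.ω p l = 0
      · simp [h0]
      · have := A.ω_homog p l h0
        simp only [Q]
        rw [if_neg (by omega), mul_zero]
  have hQ' : A.ω⁻¹ = Q := Matrix.inv_eq_right_inv hQ
  by_contra hne
  apply h
  simp only [SympData.binv, binvOf]
  rw [hQ']
  simp [Q, hne]

lemma KS_swap {a b c d : ℕ} {S Sab Scd C : Finset ℕ}
    (hab : a ≠ b) (hac : a ≠ c) (had : a ≠ d) (hbc : b ≠ c) (hbd : b ≠ d) (hcd : c ≠ d)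
    (hSab : ∀ x, x ∈ Sab ↔ x = a ∨ x = b ∨ x ∈ C)
    (hScd : ∀ x, x ∈ Scd ↔ x = c ∨ x = d ∨ x ∈ C)
    (hS : ∀ x, x ∈ S ↔ x = a ∨ x = b ∨ x = c ∨ x = d ∨ x ∈ C)
    {ψ : ↥C ≃ Fin C.card} {ψab : ↥Sab ≃ Fin Sab.card} {ψcd : ↥Scd ≃ Fin Scd.card}
    {φ φ' : ↥S ≃ Fin S.card} (h1 : IsExt a b Sab C ψ ψab) (h2 : IsExt c d Scd C ψ ψcd)
    (h3 : IsExt c d S Sab ψab φ) (h4 : IsExt a b S Scd ψcd φ')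
    (D : ↥S → ℤ) (ha' : a ∈ S) (hb' : b ∈ S) (hc' : c ∈ S) (hd' : d ∈ S)
    (hDab : D ⟨a, ha'⟩ + D ⟨b, hb'⟩ = 1) (hDcd : D ⟨c, hc'⟩ + D ⟨d, hd'⟩ = 1) :
    KS k D φ φ' = -1 := by
  have ma : a ∈ Sab := (hSab a).2 (by simp)
  have mb : b ∈ Sab := (hSab b).2 (by simp)
  have mc : c ∈ Scd := (hScd c).2 (by simp)
  have md : d ∈ Scd := (hScd d).2 (by simp)
  have pc : (φ ⟨c, hc'⟩ : ℕ) = 0 := (h3.1 _).1 rfl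
  have pd : (φ ⟨d, hd'⟩ : ℕ) = 1 := (h3.2.1 _).1 rfl
  have pa : (φ ⟨a, ha'⟩ : ℕ) = 2 := by
    rw [h3.2.2 _ ma, (h1.1 _).1 rfl]
  have pb : (φ ⟨b, hb'⟩ : ℕ) = 3 := by
    rw [h3.2.2 _ mb, (h1.2.1 _).1 rfl]
  have qa : (φ' ⟨a, ha'⟩ : ℕ) = 0 := (h4.1 _).1 rfl
  have qb : (φ' ⟨b, hb'⟩ : ℕ) = 1 := (h4.2.1 _).1 rfl
  have qc : (φ' ⟨c, hc'⟩ : ℕ) = 2 := by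
    rw [h4.2.2 _ mc, (h2.1 _).1 rfl]
  have qd : (φ' ⟨d, hd'⟩ : ℕ) = 3 := by
    rw [h4.2.2 _ md, (h2.2.1 _).1 rfl]
  let e : Fin 4 → ↥S := ![⟨c, hc'⟩, ⟨d, hd'⟩, ⟨a, ha'⟩, ⟨b, hb'⟩]
  have he : Function.Injective e := by
    intro u v h
    have h' : (φ (e u) : ℕ) = φ (e v) := by rw [h]
    fin_cases u <;> fin_cases v <;> simp [e, pa, pb, pc, pd] at h' ⊢
  have hr : ∀ u : ↥S, u ∉ Set.range e → (φ u : ℕ) = φ' u ∧ 4 ≤ (φ u : ℕ) := by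
    rintro ⟨u, hu⟩ hn
    rcases (hS u).1 hu with h | h | h | h | h
    · subst h; exact absurd ⟨2, rfl⟩ hn
    · subst h; exact absurd ⟨3, rfl⟩ hn
    · subst h; exact absurd ⟨0, rfl⟩ hn
    · subst h; exact absurd ⟨1, rfl⟩ hn
    · have m1 : u ∈ Sab := (hSab u).2 (by simp [h])
      have m2 : u ∈ Scd := (hScd u).2 (by simp [h])
      rw [h3.2.2 _ m1, h4.2.2 _ m2, h1.2.2 _ h, h2.2.2 _ h]
      constructor
      · rfl
      · omega
  have hall : ∀ u : ↥S, ((φ u : ℕ) = φ' u ∧ 4 ≤ (φ u : ℕ)) ∨ ((φ u : ℕ) < 4 ∧ (φ' u : ℕ) < 4) := by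
    intro u
    by_cases hu : u ∈ Set.range e
    · right
      obtain ⟨w, rfl⟩ := hu
      fin_cases w <;> simp [e, pa, pb, pc, pd, qa, qb, qc, qd]
    · exact Or.inl (hr u hu)
  have key : ∀ u v : ↥S, u ∉ Set.range e ∨ v ∉ Set.range e →
      ¬ (φ u < φ v ∧ φ' v < φ' u ∧ Odd (D u) ∧ Odd (D v)) := by
    rintro u v h ⟨k1, k2, -, -⟩
    rw [Fin.lt_def] at k1 k2
    have := hall u
    have := hall v
    rcases h with h | h
    · have := hr u h
      omega
    · have := hr v h
      omega
  have step : KS k D φ φ' = ∏ u : Fin 4, ∏ v : Fin 4,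
      if φ (e u) < φ (e v) ∧ φ' (e v) < φ' (e u) ∧ Odd (D (e u)) ∧ Odd (D (e v))
        then (-1 : k) else 1 := by
    unfold KS
    symm
    refine Fintype.prod_of_injective e he _ _ ?_ ?_
    · intro u hu
      exact Finset.prod_eq_one fun v _ => if_neg (key u v (Or.inl hu))
    · intro u
      refine Fintype.prod_of_injective e he _ _ ?_ ?_
      · intro v hv
        exact if_neg (key _ v (Or.inr hv))
      · intro v
        rfl
  rw [step]
  simp only [Fin.prod_univ_four, e, Fin.lt_def]
  simp only [Matrix.cons_val, pa, pb, pc, pd, qa, qb, qc, qd]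
  have ob : Odd (D ⟨b, hb'⟩) ↔ ¬ Odd (D ⟨a, ha'⟩) := by
    simp only [Int.odd_iff]; omega
  have od : Odd (D ⟨d, hd'⟩) ↔ ¬ Odd (D ⟨c, hc'⟩) := by
    simp only [Int.odd_iff]; omega
  simp only [ob, od]
  by_cases o1 : Odd (D ⟨a, ha'⟩) <;> by_cases o2 : Odd (D ⟨c, hc'⟩) <;> simp [o1, o2]

end Helpers


/-- the contractions of the twisted endomorphism operad anticommute:
`ξ_{ab} ∘ ξ_{cd} = − ξ_{cd} ∘ ξ_{ab}` as maps
`End_A(C⊔{a,b,c,d},G) → End_A(C,G+2)`. -/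
theorem statement4 {k : Type} [Field k] {ι : Type} [Fintype ι] [DecidableEq ι]
    (A : SympData k ι) (a b c d : ℕ) (C : Finset ℕ) (G : ℕ)
    (hab : a ≠ b) (hac : a ≠ c) (had : a ≠ d) (hbc : b ≠ c) (hbd : b ≠ d) (hcd : c ≠ d)
    (ha : a ∉ C) (hb : b ∉ C) (hc : c ∉ C) (hd : d ∉ C)
    (hst : StableCorolla (insert a (insert b (insert c (insert d C)))) G)
    (df : ℤ) (f : EndS A (insert a (insert b (insert c (insert d C)))))
    (hf : IsHomogEnd A f df) :
    xiEl A a b (insert a (insert b C)) C (df + 1)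
        (xiEl A c d (insert a (insert b (insert c (insert d C)))) (insert a (insert b C)) df f) =
      - xiEl A c d (insert c (insert d C)) C (df + 1)
        (xiEl A a b (insert a (insert b (insert c (insert d C)))) (insert c (insert d C)) df f) := by
  have hSab : ∀ x, x ∈ insert a (insert b C) ↔ x = a ∨ x = b ∨ x ∈ C := by simp
  have hScd : ∀ x, x ∈ insert c (insert d C) ↔ x = c ∨ x = d ∨ x ∈ C := by simp
  have hS : ∀ x, x ∈ insert a (insert b (insert c (insert d C))) ↔
      x = a ∨ x = b ∨ x = c ∨ x = d ∨ x ∈ C := by simp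
  generalize hSe : insert a (insert b (insert c (insert d C))) = S at *
  generalize hSabe : insert a (insert b C) = Sab at *
  generalize hScde : insert c (insert d C) = Scd at *
  have hS1 : ∀ x, x ∈ S ↔ x = a ∨ x = b ∨ x ∈ Scd := by
    intro x; rw [hS, hScd]
  have hS2 : ∀ x, x ∈ S ↔ x = c ∨ x = d ∨ x ∈ Sab := by
    intro x; rw [hS, hSab]; tauto
  have hcab : c ∉ Sab := by rw [hSab]; tauto
  have hdab : d ∉ Sab := by rw [hSab]; tauto
  have hacd : a ∉ Scd := by rw [hScd]; tauto
  have hbcd : b ∉ Scd := by rw [hScd]; tauto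
  apply end_ext
  intro ψ I
  obtain ⟨ψab, h1⟩ := exists_ext hab ha hb hSab ψ
  obtain ⟨ψcd, h2⟩ := exists_ext hcd hc hd hScd ψ
  obtain ⟨φ, h3⟩ := exists_ext hcd hcab hdab hS2 ψab
  obtain ⟨φ', h4⟩ := exists_ext hab hacd hbcd hS1 ψcd
  obtain ⟨x, rfl⟩ : ∃ x : ↥C → ι, I = x ∘ ψ.symm := ⟨I ∘ ψ, by funext p; simp⟩
  rw [LinearMap.neg_apply, xi_spec A hab ha hb hSab _ _ h1, xi_spec A hcd hc hd hScd _ _ h2]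
  simp only [xi_spec A hcd hcab hdab hS2 _ _ h3, xi_spec A hab hacd hbcd hS1 _ _ h4]
  rw [← mul_neg]
  congr 1
  simp only [Finset.mul_sum, ← Finset.sum_neg_distrib]
  have hcomm : ∀ g : ι → ι → ι → ι → k, ∑ p, ∑ q, ∑ i, ∑ j, g p q i j =
      ∑ i, ∑ j, ∑ p, ∑ q, g p q i j := by
    intro g
    have e1 : ∀ F : ι → ι → k, ∑ p, ∑ q, F p q = ∑ z : ι × ι, F z.1 z.2 := fun F =>
      (Fintype.sum_prod_type' F).symm
    rw [e1, e1]
    simp only [e1]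
    exact Finset.sum_comm
  rw [hcomm]
  refine Finset.sum_congr rfl fun p _ => Finset.sum_congr rfl fun q _ =>
    Finset.sum_congr rfl fun i _ => Finset.sum_congr rfl fun j _ => ?_
  by_cases hz : A.binv i j = 0
  · simp [hz]
  by_cases hz' : A.binv p q = 0
  · simp [hz']
  have hij := binv_homog A i j hz
  have hpq := binv_homog A p q hz'
  have ma : a ∈ S := (hS a).2 (by simp)
  have mb : b ∈ S := (hS b).2 (by simp)
  have mc : c ∈ S := (hS c).2 (by simp)
  have md : d ∈ S := (hS d).2 (by simp)
  have hx : xExt c S Sab (xExt a Sab C x i j) p q = xExt a S Scd (xExt c Scd C x p q) i j := by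
    funext ⟨u, hu⟩
    rcases (hS u).1 hu with h | h | h | h | h
    · subst h
      simp [xExt, hSab, hScd, *]
    · subst h
      simp [xExt, hSab, hScd, hab.symm, *]
    · subst h
      simp [xExt, hSab, hScd, hac.symm, hbc.symm, *]
    · subst h
      simp [xExt, hSab, hScd, had.symm, hbd.symm, hcd.symm, *]
    · simp [xExt, hSab, hScd, h]
  rw [end_single A f φ φ', hx]
  rw [KS_swap hab hac had hbc hbd hcd hSab hScd hS h1 h2 h3 h4 _ ma mb mc md]
  · ring
  · simpa [xExt, hacd, hbcd, hab.symm] using hij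
  · rw [← hx]
    simpa [xExt, hcab, hdab, hcd.symm] using hpq

end Paper
end
end

section
/- Let (A,d,ω) be a dg symplectic space. The compositions of the endomorphism operad satisfy the twisted associativity axiom: ∘_{a,b} ∘ (id ⊗ ∘_{c,d}) = − ∘_{c,d} ∘ (∘_{a,b} ⊗ id) as maps End_A(C₁⊔{a},G₁) ⊗ End_A(C₂⊔{b,c},G₂) ⊗ End_A(C₃⊔{d},G₃) → End_A(C₁⊔C₂⊔C₃, G₁+G₂+G₃), where tensor products of the degree +1 maps ∘ with identities are evaluated with Koszul signs. -/
open Finset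

noncomputable section

namespace Paper

section Aux

variable {k : Type} [Field k]

lemma msign_add (m n : ℤ) : msign k (m + n) = msign k m * msign k n := by
  unfold msign
  by_cases hm : Odd m <;> by_cases hn : Odd n <;> simp [hm, hn, Int.odd_add, ← Int.not_odd_iff_even]

lemma msign_congr {m n : ℤ} (h : (m : ZMod 2) = (n : ZMod 2)) : msign k m = msign k n := by
  have h2 : m ≡ n [ZMOD 2] := (ZMod.intCast_eq_intCast_iff _ _ 2).1 h
  unfold msign
  have : Odd m ↔ Odd n := by
    rw [Int.odd_iff, Int.odd_iff, h2]
  simp [this]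

lemma msign_neg_one_mul (m : ℤ) : - msign k m = msign k (m + 1) := by
  rw [msign_add]; simp [msign]

lemma prod_pair_insert {M : Type} [CommMonoid M] (t : ℕ → ℕ → M) {c : ℕ} {T : Finset ℕ} (hc : c ∉ T) :
    ∏ p ∈ insert c T, ∏ q ∈ insert c T, t p q =
      t c c * (∏ q ∈ T, t c q * t q c) * ∏ p ∈ T, ∏ q ∈ T, t p q := by
  rw [Finset.prod_insert hc, Finset.prod_insert hc]
  simp_rw [Finset.prod_insert hc]
  rw [Finset.prod_mul_distrib, Finset.prod_mul_distrib]
  simp only [mul_assoc]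

lemma prod_pair_congr {M : Type} [CommMonoid M] (t t' : ℕ → ℕ → M) (S : Finset ℕ)
    (h0 : ∀ p ∈ S, t p p = t' p p)
    (h : ∀ p ∈ S, ∀ q ∈ S, p ≠ q → t p q * t q p = t' p q * t' q p) :
    ∏ p ∈ S, ∏ q ∈ S, t p q = ∏ p ∈ S, ∏ q ∈ S, t' p q := by
  induction S using Finset.induction_on with
  | empty => simp
  | insert c T hc ih =>
    rw [prod_pair_insert t hc, prod_pair_insert t' hc, h0 c (by simp),
      ih (fun p hp => h0 p (by simp [hp])) (fun p hp q hq => h p (by simp [hp]) q (by simp [hq]))]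
    congr 2
    refine Finset.prod_congr rfl fun q hq => h c (by simp) q (by simp [hq]) ?_
    rintro rfl; exact hc hq

lemma prod_pair_union {M : Type} [CommMonoid M] (t : ℕ → ℕ → M) (S T : Finset ℕ) (hd : Disjoint S T)
    (h : ∀ p ∈ S, ∀ q ∈ T, t p q * t q p = 1) :
    ∏ p ∈ S ∪ T, ∏ q ∈ S ∪ T, t p q =
      (∏ p ∈ S, ∏ q ∈ S, t p q) * ∏ p ∈ T, ∏ q ∈ T, t p q := by
  rw [Finset.prod_union hd]
  simp_rw [Finset.prod_union hd, Finset.prod_mul_distrib]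
  have : (∏ p ∈ S, ∏ q ∈ T, t p q) * (∏ p ∈ T, ∏ q ∈ S, t p q) = 1 := by
    rw [Finset.prod_comm (s := T), ← Finset.prod_mul_distrib]
    refine Finset.prod_eq_one fun p hp => ?_
    rw [← Finset.prod_mul_distrib]
    exact Finset.prod_eq_one fun q hq => h p hp q hq
  calc _ = (∏ p ∈ S, ∏ q ∈ S, t p q) * (∏ p ∈ T, ∏ q ∈ T, t p q) *
        ((∏ p ∈ S, ∏ q ∈ T, t p q) * (∏ p ∈ T, ∏ q ∈ S, t p q)) := by ac_rfl
    _ = _ := by rw [this, mul_one]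

variable (k) in
def KK (e : ℕ → ℤ) (S : Finset ℕ) (u v : ℕ → ℕ) : k :=
  ∏ p ∈ S, ∏ q ∈ S, if u p < u q ∧ v q < v p ∧ Odd (e p) ∧ Odd (e q) then (-1 : k) else 1

lemma KK_self (e : ℕ → ℤ) (S : Finset ℕ) (u v : ℕ → ℕ)
    (h : ∀ p ∈ S, ∀ q ∈ S, u p < u q → v p ≤ v q) : KK k e S u v = 1 := by
  refine Finset.prod_eq_one fun p hp => Finset.prod_eq_one fun q hq => ?_
  rw [if_neg]
  rintro ⟨h1, h2, -⟩
  exact absurd (h p hp q hq h1) (by omega)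

lemma KK_cocycle (e : ℕ → ℤ) (S : Finset ℕ) (u v w : ℕ → ℕ)
    (hu : Set.InjOn u S) (hv : Set.InjOn v S) (hw : Set.InjOn w S) :
    KK k e S u v * KK k e S v w = KK k e S u w := by
  unfold KK
  simp_rw [← Finset.prod_mul_distrib]
  refine prod_pair_congr _ _ S (by simp) fun p hp q hq hpq => ?_
  have h1 : u p ≠ u q := fun h => hpq (hu hp hq h)
  have h2 : v p ≠ v q := fun h => hpq (hv hp hq h)
  have h3 : w p ≠ w q := fun h => hpq (hw hp hq h)
  by_cases ho : Odd (e p)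
  swap
  · simp [ho]
  by_cases ho' : Odd (e q)
  swap
  · simp [ho']
  rcases h1.lt_or_gt with h1 | h1 <;> rcases h2.lt_or_gt with h2 | h2 <;>
    rcases h3.lt_or_gt with h3 | h3 <;>
    simp [ho, ho', h1, h2, h3, h1.le, h2.le, h3.le, not_lt_of_gt]

lemma KK_congr (e e' : ℕ → ℤ) (S : Finset ℕ) (u v u' v' : ℕ → ℕ)
    (he : ∀ p ∈ S, e p = e' p)
    (hu : ∀ p ∈ S, ∀ q ∈ S, (u p < u q ↔ u' p < u' q))
    (hv : ∀ p ∈ S, ∀ q ∈ S, (v p < v q ↔ v' p < v' q)) :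
    KK k e S u v = KK k e' S u' v' := by
  unfold KK
  refine Finset.prod_congr rfl fun p hp => Finset.prod_congr rfl fun q hq => ?_
  simp only [he p hp, he q hq, hu p hp q hq, hv q hq p hp]

lemma KK_union (e : ℕ → ℤ) (S T : Finset ℕ) (u v : ℕ → ℕ) (hd : Disjoint S T)
    (hu : ∀ p ∈ S, ∀ q ∈ T, u p < u q) (hv : ∀ p ∈ S, ∀ q ∈ T, v p < v q) :
    KK k e (S ∪ T) u v = KK k e S u v * KK k e T u v := by
  refine prod_pair_union _ S T hd fun p hp q hq => ?_
  have h1 := hu p hp q hq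
  have h2 := hv p hp q hq
  simp [h1, h2, h1.le, h2.le, not_lt_of_gt]

lemma KK_insert (e : ℕ → ℤ) (c : ℕ) (T : Finset ℕ) (u v : ℕ → ℕ) (hc : c ∉ T)
    (hu : ∀ q ∈ T, u c < u q) (hv : ∀ q ∈ T, v c < v q) :
    KK k e (insert c T) u v = KK k e T u v := by
  rw [Finset.insert_eq, KK_union e {c} T u v (by simpa using hc) (by simpa using hu) (by simpa using hv)]
  simp [KK]

lemma KK_move (e : ℕ → ℤ) (c : ℕ) (B R : Finset ℕ) (u v : ℕ → ℕ) (hB : c ∉ B) (hR : c ∉ R)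
    (hBR : Disjoint B R)
    (hu : ∀ q ∈ B ∪ R, u c < u q) (hvB : ∀ q ∈ B, v q < v c) (hvR : ∀ q ∈ R, v c < v q)
    (huv : ∀ p ∈ B ∪ R, ∀ q ∈ B ∪ R, u p < u q → v p ≤ v q) :
    KK k e (insert c (B ∪ R)) u v = msign k (e c * ∑ q ∈ B, e q) := by
  have hc : c ∉ B ∪ R := by simp [hB, hR]
  unfold KK
  rw [prod_pair_insert _ hc]
  have h1 := KK_self (k := k) e _ u v huv
  unfold KK at h1
  rw [h1, Finset.prod_union hBR]
  rw [Finset.prod_eq_one (s := R)]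
  swap
  · intro q hq
    have h1 := hu q (by simp [hq])
    have h2 := hvR q hq
    simp [h1, h2, h1.le, h2.le, not_lt_of_gt]
  simp only [lt_self_iff_false, false_and, if_false, one_mul, mul_one]
  clear h1 huv hc hBR hR
  induction B using Finset.induction_on with
  | empty => simp [msign]
  | insert b B hb ih =>
    rw [Finset.prod_insert hb, Finset.sum_insert hb, mul_add, msign_add, ih]
    · congr 1
      have h1 := hu b (by simp)
      have h2 := hvB b (by simp)
      by_cases ho : Odd (e c) <;> by_cases ho' : Odd (e b) <;>
        simp [h1, h2, h1.le, h2.le, ho, ho', msign, Int.odd_mul, not_lt_of_gt]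
    · simp at hB; tauto
    · intro q hq; apply hu; simp at hq ⊢; tauto
    · intro q hq; apply hvB; simp [hq]

/-- extension of an ordering to all naturals -/
def key {S : Finset ℕ} (ψ : ↥S ≃ Fin S.card) : ℕ → ℕ :=
  fun n => if h : n ∈ S then (ψ ⟨n, h⟩ : ℕ) else 0

lemma key_mem {S : Finset ℕ} (ψ : ↥S ≃ Fin S.card) {n : ℕ} (h : n ∈ S) :
    key ψ n = (ψ ⟨n, h⟩ : ℕ) := by simp [key, h]

lemma key_coe {S : Finset ℕ} (ψ : ↥S ≃ Fin S.card) (n : ↥S) :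
    key ψ n = (ψ n : ℕ) := by simp [key]

lemma key_inj {S : Finset ℕ} (ψ : ↥S ≃ Fin S.card) : Set.InjOn (key ψ) S := by
  intro p hp q hq h
  rw [key_mem ψ hp, key_mem ψ hq] at h
  simpa using ψ.injective (Fin.ext h)

lemma exists_equiv (S : Finset ℕ) (u : ℕ → ℕ) (hu : Set.InjOn u S) (hlt : ∀ x ∈ S, u x < S.card) :
    ∃ ψ : ↥S ≃ Fin S.card, ∀ x ∈ S, key ψ x = u x := by
  have hinj : Function.Injective (fun x : ↥S => (⟨u x, hlt x x.2⟩ : Fin S.card)) := by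
    intro x y h
    simp only [Fin.mk.injEq] at h
    exact Subtype.ext (hu x.2 y.2 h)
  have hb := (Fintype.bijective_iff_injective_and_card _).2 ⟨hinj, by simp⟩
  refine ⟨Equiv.ofBijective _ hb, fun x hx => ?_⟩
  simp [key, hx]

variable {ι : Type} [Fintype ι] [DecidableEq ι] (A : SympData k ι)

def val {S : Finset ℕ} (f : EndS A S) (ψ : ↥S ≃ Fin S.card) (x : ℕ → ι) : k :=
  f (iota k ι A.deg S ψ (Finsupp.single (fun r => x (ψ.symm r)) 1))

lemma val_congr {S : Finset ℕ} (f : EndS A S) (ψ : ↥S ≃ Fin S.card) {x y : ℕ → ι}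
    (h : ∀ s ∈ S, x s = y s) : val A f ψ x = val A f ψ y := by
  unfold val
  congr; funext r; exact h _ (ψ.symm r).2

lemma koszul_eq {S : Finset ℕ} (ψ : ↥S ≃ Fin S.card) (τ : Equiv.Perm (Fin S.card)) (e : ℕ → ℤ) :
    koszulSign k (fun r => e (ψ.symm r)) τ = KK k e S (key ψ) (key (ψ.trans τ)) := by
  unfold koszulSign KK
  rw [← Finset.prod_coe_sort S, ← Equiv.prod_comp ψ]
  refine Finset.prod_congr rfl fun p _ => ?_
  rw [← Finset.prod_coe_sort S, ← Equiv.prod_comp ψ]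
  refine Finset.prod_congr rfl fun q _ => ?_
  simp [key_coe]

lemma iPre_single (S : Finset ℕ) (ψ : ↥S ≃ Fin S.card) (I : Fin S.card → ι) (r : k) :
    iPre k ι S ψ (Finsupp.single I r) = Finsupp.single (ψ, I) r := by
  simp [iPre]

lemma permAct_single (n : ℕ) (deg : ι → ℤ) (τ : Equiv.Perm (Fin n)) (I : Fin n → ι) :
    permAct k ι deg τ (Finsupp.single I 1) =
      koszulSign k (fun p => deg (I p)) τ • Finsupp.single (I ∘ τ.symm) (1 : k) := by
  rw [permAct, Finsupp.lift_apply, Finsupp.sum_single_index] <;> simp only [one_smul, zero_smul]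

lemma val_change {S : Finset ℕ} (f : EndS A S) (ψ ψ' : ↥S ≃ Fin S.card) (x : ℕ → ι) :
    val A f ψ x = KK k (fun n => A.deg (x n)) S (key ψ) (key ψ') * val A f ψ' x := by
  have hτ : ψ.trans (ψ.symm.trans ψ') = ψ' := by ext; simp
  have hK := koszul_eq (k := k) ψ (ψ.symm.trans ψ') (fun n => A.deg (x n))
  rw [hτ] at hK
  have : iota k ι A.deg S ψ (Finsupp.single (fun r => x (ψ.symm r)) 1) =
      iota k ι A.deg S ψ' (permAct k ι A.deg (ψ.symm.trans ψ')
        (Finsupp.single (fun r => x (ψ.symm r)) 1)) := by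
    unfold iota
    rw [LinearMap.comp_apply, LinearMap.comp_apply, ← sub_eq_zero, ← map_sub, Submodule.mkQ_apply,
      Submodule.Quotient.mk_eq_zero]
    refine Submodule.subset_span ⟨ψ, ψ.symm.trans ψ', _, by rw [hτ]⟩
  unfold val
  rw [this, permAct_single, hK, map_smul, map_smul, smul_eq_mul]
  have hI : (fun r => x (ψ.symm r)) ∘ (ψ.symm.trans ψ').symm = fun r => x (ψ'.symm r) := by
    funext r; simp
  rw [hI]

def extI [Nonempty ι] {S : Finset ℕ} (ψ : ↥S ≃ Fin S.card) (I : Fin S.card → ι) : ℕ → ι :=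
  fun n => if h : n ∈ S then I (ψ ⟨n, h⟩) else Classical.arbitrary ι

lemma extI_symm [Nonempty ι] {S : Finset ℕ} (ψ : ↥S ≃ Fin S.card) (I : Fin S.card → ι) :
    (fun r => extI ψ I (ψ.symm r)) = I := by
  funext r; simp [extI]

lemma end_ext0 {S : Finset ℕ} (f g : EndS A S)
    (h : ∀ ψ I, f (iota k ι A.deg S ψ (Finsupp.single I 1)) = g (iota k ι A.deg S ψ (Finsupp.single I 1))) :
    f = g := by
  refine Submodule.linearMap_qext _ (Finsupp.lhom_ext' fun ⟨ψ, I⟩ => LinearMap.ext_ring ?_)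
  have := h ψ I
  simpa [iota, iPre_single] using this

lemma end_ext_s5 [Nonempty ι] {S : Finset ℕ} (f g : EndS A S) (ψ₀ : ↥S ≃ Fin S.card)
    (h : ∀ x, val A f ψ₀ x = val A g ψ₀ x) : f = g := by
  refine end_ext0 A f g fun ψ I => ?_
  have := val_change A f ψ ψ₀ (extI ψ I)
  rw [h, ← val_change A g ψ ψ₀ (extI ψ I)] at this
  simpa only [val, extI_symm] using this

lemma exists_val [Nonempty ι] {S : Finset ℕ} (ψ₀ : ↥S ≃ Fin S.card) (V : (ℕ → ι) → k)
    (hV : ∀ x y, (∀ s ∈ S, x s = y s) → V x = V y) :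
    ∃ f : EndS A S, ∀ ψ x, val A f ψ x =
      KK k (fun n => A.deg (x n)) S (key ψ) (key ψ₀) * V x := by
  let F : PreT k ι S →ₗ[k] k := Finsupp.lift k k _ (fun y =>
      KK k (fun n => A.deg (extI y.1 y.2 n)) S (key y.1) (key ψ₀) * V (extI y.1 y.2))
  have hFs : ∀ ψ I, F (Finsupp.single (ψ, I) 1) =
      KK k (fun n => A.deg (extI ψ I n)) S (key ψ) (key ψ₀) * V (extI ψ I) := by
    intro ψ I; simp [F]
  have hF : tensRel k ι A.deg S ≤ LinearMap.ker F := by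
    refine Submodule.span_le.2 ?_
    rintro _ ⟨ψ, τ, v, rfl⟩
    simp only [SetLike.mem_coe, LinearMap.mem_ker, map_sub, sub_eq_zero]
    suffices F ∘ₗ iPre k ι S ψ = F ∘ₗ iPre k ι S (ψ.trans τ) ∘ₗ permAct k ι A.deg τ from
      LinearMap.congr_fun this v
    refine Finsupp.lhom_ext' fun I => LinearMap.ext_ring ?_
    simp only [LinearMap.comp_apply, Finsupp.lsingle_apply, permAct_single, map_smul, iPre_single, hFs]
    have hx : extI (ψ.trans τ) (I ∘ τ.symm) = extI ψ I := by
      funext n; simp [extI]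
    have hK := koszul_eq (k := k) ψ τ (fun n => A.deg (extI ψ I n))
    have h2 := congrFun (extI_symm ψ I)
    simp only [h2] at hK
    rw [hx, hK, smul_eq_mul, ← mul_assoc, KK_cocycle _ _ _ _ _ (key_inj _) (key_inj _) (key_inj _)]
  refine ⟨(tensRel k ι A.deg S).liftQ F hF, fun ψ x => ?_⟩
  have hx : ∀ s ∈ S, extI ψ (fun r => x (ψ.symm r)) s = x s := by
    intro s hs; simp [extI, hs]
  simp only [val, iota, LinearMap.comp_apply, Submodule.mkQ_apply, Submodule.liftQ_apply, iPre_single, hFs]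
  rw [hV _ _ hx]
  congr 1
  exact KK_congr _ _ _ _ _ _ _ (fun p hp => by rw [hx p hp]) (fun _ _ _ _ => Iff.rfl)
    (fun _ _ _ _ => Iff.rfl)

/-- compatibility of orderings -/
structure Compat (a b : ℕ) (C₁ C₂ S₁ S₂ D : Finset ℕ) (u u₁ u₂ : ℕ → ℕ) : Prop where
  c0 : ∀ x ∈ C₁, u x < C₁.card
  c1 : ∀ x ∈ S₁, (x = a ↔ u₁ x = 0)
  c2 : ∀ x ∈ C₁, u₁ x = u x + 1
  c3 : ∀ x ∈ S₂, (x = b ↔ u₂ x = 0)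
  c4 : ∀ x ∈ C₂, u₂ x + C₁.card = u x + 1

/-- set hypotheses -/
structure SetH (a b : ℕ) (C₁ C₂ S₁ S₂ D : Finset ℕ) : Prop where
  s1 : S₁ = insert a C₁
  s2 : S₂ = insert b C₂
  sD : D = C₁ ∪ C₂
  dj : Disjoint C₁ C₂
  a1 : a ∉ C₁
  a2 : a ∉ C₂
  b1 : b ∉ C₁
  b2 : b ∉ C₂

def rhs (a b : ℕ) (C₁ : Finset ℕ) {S₁ S₂ : Finset ℕ} (df dg : ℤ)
    (f : EndS A S₁) (g : EndS A S₂) (ψ₁ : ↥S₁ ≃ Fin S₁.card) (ψ₂ : ↥S₂ ≃ Fin S₂.card) (x : ℕ → ι) : k :=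
  ∑ i : ι, ∑ j : ι,
    msign k (df + dg * (1 - A.deg i) + (dg + 1 - A.deg i) * ∑ s ∈ C₁, A.deg (x s)) *
      A.binv i j * val A f ψ₁ (Function.update x a i) * val A g ψ₂ (Function.update x b j)

lemma compProp_iff [Nonempty ι] {a b : ℕ} {C₁ C₂ S₁ S₂ D : Finset ℕ} (H : SetH a b C₁ C₂ S₁ S₂ D)
    (df dg : ℤ) (f : EndS A S₁) (g : EndS A S₂) (h : EndS A D) :
    CompProp A a b C₁ C₂ S₁ S₂ D df dg f g h ↔
      ∀ (ψ : ↥D ≃ Fin D.card) (ψ₁ : ↥S₁ ≃ Fin S₁.card) (ψ₂ : ↥S₂ ≃ Fin S₂.card),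
        Compat a b C₁ C₂ S₁ S₂ D (key ψ) (key ψ₁) (key ψ₂) →
        ∀ x, val A h ψ x = rhs A a b C₁ df dg f g ψ₁ ψ₂ x := by
  obtain ⟨rfl, rfl, rfl, dj, a1, a2, b1, b2⟩ := H
  have key1 : ∀ (ψ : ↥(C₁ ∪ C₂) ≃ Fin (C₁ ∪ C₂).card) (ψ₁ : ↥(insert a C₁) ≃ Fin (insert a C₁).card)
     (x : ℕ → ι) (p : ι), (fun r => if hx : ((ψ₁.symm r : ℕ) ∈ C₁ ∪ C₂) ∧ ((ψ₁.symm r : ℕ) ∈ C₁)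
                  then x (ψ.symm (ψ ⟨(ψ₁.symm r : ℕ), hx.1⟩)) else p) = fun r => Function.update x a p (ψ₁.symm r) := by
    intro ψ ψ₁ x p
    funext r
    have hm := (ψ₁.symm r).2
    rw [Finset.mem_insert] at hm
    rcases hm with hm | hm
    · simp [hm, a1]
    · have : (ψ₁.symm r : ℕ) ≠ a := fun h => a1 (h ▸ hm)
      simp [hm, this]
  have key2 : ∀ (ψ : ↥(C₁ ∪ C₂) ≃ Fin (C₁ ∪ C₂).card) (ψ₁ : ↥(insert b C₂) ≃ Fin (insert b C₂).card)
     (x : ℕ → ι) (p : ι), (fun r => if hx : ((ψ₁.symm r : ℕ) ∈ C₁ ∪ C₂) ∧ ((ψ₁.symm r : ℕ) ∈ C₂)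
                  then x (ψ.symm (ψ ⟨(ψ₁.symm r : ℕ), hx.1⟩)) else p) = fun r => Function.update x b p (ψ₁.symm r) := by
    intro ψ ψ₁ x p
    funext r
    have hm := (ψ₁.symm r).2
    rw [Finset.mem_insert] at hm
    rcases hm with hm | hm
    · simp [hm, b2]
    · have : (ψ₁.symm r : ℕ) ≠ b := fun h => b2 (h ▸ hm)
      simp [hm, this]
  have key3 : ∀ (ψ : ↥(C₁ ∪ C₂) ≃ Fin (C₁ ∪ C₂).card) (x : ℕ → ι),
      (∑ s : ↥(C₁ ∪ C₂), if (s : ℕ) ∈ C₁ then A.deg (x (ψ.symm (ψ s))) else 0) = ∑ s ∈ C₁, A.deg (x s) := by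
    intro ψ x
    simp only [Equiv.symm_apply_apply]
    rw [Finset.sum_coe_sort (C₁ ∪ C₂) (fun s => if s ∈ C₁ then A.deg (x s) else 0), ← Finset.sum_filter]
    congr 1
    ext s; simp only [Finset.mem_filter, Finset.mem_union]; tauto
  have hsum : ∀ (i : ι) (F : ι → k), ∑ p, (1 : Matrix ι ι k) p i * F p = F i := by
    intro i F
    simp [Matrix.one_apply]
  constructor
  · intro hc ψ ψ₁ ψ₂ hC x
    have := hc ψ ψ₁ ψ₂ (fun s hs => by rw [← key_coe]; exact hC.c0 s hs)
      (fun s => by rw [← key_coe]; exact hC.c1 s s.2)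
      (fun s hs hs' => by rw [← key_coe, ← key_mem]; exact hC.c2 s hs')
      (fun s => by rw [← key_coe]; exact hC.c3 s s.2)
      (fun s hs hs' => by rw [← key_coe, ← key_mem]; exact hC.c4 s hs') (fun r => x (ψ.symm r))
    simp only [hsum, key1, key2, key3, Matrix.transpose_one, one_mul, mul_one] at this
    exact this
  · intro hc ψ ψ₁ ψ₂ h0 h1 h2 h3 h4 I
    obtain ⟨x, hx⟩ : ∃ x : ℕ → ι, I = fun r => x (ψ.symm r) := ⟨extI ψ I, (extI_symm ψ I).symm⟩
    have := hc ψ ψ₁ ψ₂ ⟨fun s hs => by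
        have hm : s ∈ C₁ ∪ C₂ := by simp [hs]
        rw [key_mem _ hm]; exact h0 ⟨s, hm⟩ hs,
      fun s hs => by rw [key_mem _ hs]; exact h1 ⟨s, hs⟩,
      fun s hs => by
        have hm : s ∈ C₁ ∪ C₂ := by simp [hs]
        have hm' : s ∈ insert a C₁ := by simp [hs]
        rw [key_mem _ hm, key_mem _ hm']; exact h2 ⟨s, hm'⟩ hm hs,
      fun s hs => by rw [key_mem _ hs]; exact h3 ⟨s, hs⟩,
      fun s hs => by
        have hm : s ∈ C₁ ∪ C₂ := by simp [hs]
        have hm' : s ∈ insert b C₂ := by simp [hs]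
        rw [key_mem _ hm, key_mem _ hm']; exact h4 ⟨s, hm'⟩ hm hs⟩ x
    subst hx
    simp only [hsum, key1, key2, key3, Matrix.transpose_one, one_mul, mul_one]
    exact this

lemma exists_enum (C : Finset ℕ) : ∃ e : ℕ → ℕ, Set.InjOn e C ∧ ∀ x ∈ C, e x < C.card :=
  ⟨key C.equivFin, key_inj _, fun x hx => by rw [key_mem _ hx]; exact Fin.is_lt _⟩

lemma exists_blocks (S B₁ B₂ B₃ : Finset ℕ) (hS : S = B₁ ∪ B₂ ∪ B₃) (h12 : Disjoint B₁ B₂)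
    (h13 : Disjoint B₁ B₃) (h23 : Disjoint B₂ B₃) (e₁ e₂ e₃ : ℕ → ℕ)
    (i1 : Set.InjOn e₁ B₁) (i2 : Set.InjOn e₂ B₂) (i3 : Set.InjOn e₃ B₃)
    (l1 : ∀ x ∈ B₁, e₁ x < B₁.card) (l2 : ∀ x ∈ B₂, e₂ x < B₂.card) (l3 : ∀ x ∈ B₃, e₃ x < B₃.card) :
    ∃ ψ : ↥S ≃ Fin S.card, (∀ x ∈ B₁, key ψ x = e₁ x) ∧ (∀ x ∈ B₂, key ψ x = B₁.card + e₂ x) ∧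
      (∀ x ∈ B₃, key ψ x = B₁.card + B₂.card + e₃ x) := by
  subst hS
  have hd : Disjoint (B₁ ∪ B₂) B₃ := Finset.disjoint_union_left.2 ⟨h13, h23⟩
  have hcard : (B₁ ∪ B₂ ∪ B₃).card = B₁.card + B₂.card + B₃.card := by
    rw [Finset.card_union_of_disjoint hd, Finset.card_union_of_disjoint h12]
  let u : ℕ → ℕ := fun x => if x ∈ B₁ then e₁ x else if x ∈ B₂ then B₁.card + e₂ x
    else B₁.card + B₂.card + e₃ x
  have u1 : ∀ x ∈ B₁, u x = e₁ x := fun x hx => by simp [u, hx]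
  have u2 : ∀ x ∈ B₂, u x = B₁.card + e₂ x := fun x hx => by
    have := Finset.disjoint_right.1 h12 hx
    simp [u, hx, this]
  have u3 : ∀ x ∈ B₃, u x = B₁.card + B₂.card + e₃ x := fun x hx => by
    have := Finset.disjoint_right.1 h13 hx
    have := Finset.disjoint_right.1 h23 hx
    simp [u, *]
  obtain ⟨ψ, hψ⟩ := exists_equiv (B₁ ∪ B₂ ∪ B₃) u (by
    intro x hx y hy hxy
    simp only [Finset.coe_union, Set.mem_union, Finset.mem_coe] at hx hy
    rcases hx with (hx | hx) | hx <;> rcases hy with (hy | hy) | hy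
    · rw [u1 x hx, u1 y hy] at hxy; exact i1 hx hy hxy
    · rw [u1 x hx, u2 y hy] at hxy; have := l1 x hx; omega
    · rw [u1 x hx, u3 y hy] at hxy; have := l1 x hx; omega
    · rw [u2 x hx, u1 y hy] at hxy; have := l1 y hy; omega
    · rw [u2 x hx, u2 y hy] at hxy; exact i2 hx hy (by omega)
    · rw [u2 x hx, u3 y hy] at hxy; have := l2 x hx; omega
    · rw [u3 x hx, u1 y hy] at hxy; have := l1 y hy; omega
    · rw [u3 x hx, u2 y hy] at hxy; have := l2 y hy; omega
    · rw [u3 x hx, u3 y hy] at hxy; exact i3 hx hy (by omega)) (by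
    intro x hx
    simp only [Finset.mem_union] at hx
    rw [hcard]
    rcases hx with (hx | hx) | hx
    · rw [u1 x hx]; have := l1 x hx; omega
    · rw [u2 x hx]; have := l2 x hx; omega
    · rw [u3 x hx]; have := l3 x hx; omega)
  refine ⟨ψ, fun x hx => ?_, fun x hx => ?_, fun x hx => ?_⟩
  · rw [hψ x (by simp [hx]), u1 x hx]
  · rw [hψ x (by simp [hx]), u2 x hx]
  · rw [hψ x (by simp [hx]), u3 x hx]

lemma exists_compat {a b : ℕ} {C₁ C₂ S₁ S₂ D : Finset ℕ} (H : SetH a b C₁ C₂ S₁ S₂ D) :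
    ∃ (ψ : ↥D ≃ Fin D.card) (ψ₁ : ↥S₁ ≃ Fin S₁.card) (ψ₂ : ↥S₂ ≃ Fin S₂.card),
      Compat a b C₁ C₂ S₁ S₂ D (key ψ) (key ψ₁) (key ψ₂) := by
  obtain ⟨e₁, i1, l1⟩ := exists_enum C₁
  obtain ⟨e₂, i2, l2⟩ := exists_enum C₂
  obtain ⟨ψ, p1, p2, -⟩ := exists_blocks D C₁ C₂ ∅ (by simp [H.sD]) H.dj (by simp) (by simp)
    e₁ e₂ e₁ i1 i2 (by simp) l1 l2 (by simp)
  obtain ⟨ψ₁, q1, q2, -⟩ := exists_blocks S₁ {a} C₁ ∅ (by simp [H.s1])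
    (by simp [H.a1]) (by simp) (by simp)
    (fun _ => 0) e₁ e₁ (by simp) i1 (by simp) (by simp) l1 (by simp)
  obtain ⟨ψ₂, r1, r2, -⟩ := exists_blocks S₂ {b} C₂ ∅ (by simp [H.s2])
    (by simp [H.b2]) (by simp) (by simp)
    (fun _ => 0) e₂ e₁ (by simp) i2 (by simp) (by simp) l2 (by simp)
  simp only [Finset.mem_singleton, forall_eq, Finset.card_singleton] at q1 q2 r1 r2
  refine ⟨ψ, ψ₁, ψ₂, ?_, ?_, ?_, ?_, ?_⟩
  · intro x hx; rw [p1 x hx]; exact l1 x hx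
  · intro x hx
    rw [H.s1, Finset.mem_insert] at hx
    rcases hx with rfl | hx
    · simp [q1]
    · have : x ≠ a := fun h => H.a1 (h ▸ hx)
      simp [q2 x hx, this]
  · intro x hx; rw [p1 x hx, q2 x hx]; omega
  · intro x hx
    rw [H.s2, Finset.mem_insert] at hx
    rcases hx with rfl | hx
    · simp [r1]
    · have : x ≠ b := fun h => H.b2 (h ▸ hx)
      simp [r2 x hx, this]
  · intro x hx; rw [p2 x hx, r2 x hx]; omega

lemma compat_lt {a b : ℕ} {C₁ C₂ S₁ S₂ D : Finset ℕ} {u u₁ u₂ : ℕ → ℕ} (H : SetH a b C₁ C₂ S₁ S₂ D)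
    (hC : Compat a b C₁ C₂ S₁ S₂ D u u₁ u₂) :
    (∀ p ∈ C₁, ∀ q ∈ C₂, u p < u q) ∧ (∀ q ∈ C₁, u₁ a < u₁ q) ∧ (∀ q ∈ C₂, u₂ b < u₂ q) := by
  obtain ⟨rfl, rfl, rfl, dj, a1, a2, b1, b2⟩ := H
  have ha : u₁ a = 0 := (hC.c1 a (by simp)).1 rfl
  have hb : u₂ b = 0 := (hC.c3 b (by simp)).1 rfl
  have h2 : ∀ q ∈ C₂, u₂ b < u₂ q := by
    intro q hq
    have : u₂ q ≠ 0 := fun h => b2 ((hC.c3 q (by simp [hq])).2 h ▸ hq)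
    omega
  refine ⟨fun p hp q hq => ?_, fun q hq => ?_, h2⟩
  · have := hC.c0 p hp
    have := hC.c4 q hq
    have := h2 q hq
    omega
  · have := hC.c2 q hq
    omega

lemma exists_compProp [Nonempty ι] {a b : ℕ} {C₁ C₂ S₁ S₂ D : Finset ℕ} (H : SetH a b C₁ C₂ S₁ S₂ D)
    (df dg : ℤ) (f : EndS A S₁) (g : EndS A S₂) :
    ∃ h : EndS A D, CompProp A a b C₁ C₂ S₁ S₂ D df dg f g h := by
  obtain ⟨ψ0, ψ10, ψ20, hC0⟩ := exists_compat H
  obtain ⟨h, hh⟩ := exists_val A ψ0 (rhs A a b C₁ df dg f g ψ10 ψ20) (by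
    intro x y hxy
    unfold rhs
    refine Finset.sum_congr rfl fun i _ => Finset.sum_congr rfl fun j _ => ?_
    have e1 : ∀ s ∈ C₁, x s = y s := fun s hs => hxy s (by simp [H.sD, hs])
    have e2 : ∀ s ∈ C₂, x s = y s := fun s hs => hxy s (by simp [H.sD, hs])
    congr 1
    · congr 1
      · congr 4
        exact Finset.sum_congr rfl fun s hs => by rw [e1 s hs]
      · refine val_congr A _ _ fun s hs => ?_
        rw [H.s1, Finset.mem_insert] at hs
        rcases hs with rfl | hs
        · simp
        · simp [Function.update_apply, e1 s hs]
    · refine val_congr A _ _ fun s hs => ?_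
      rw [H.s2, Finset.mem_insert] at hs
      rcases hs with rfl | hs
      · simp
      · simp [Function.update_apply, e2 s hs])
  refine ⟨h, (compProp_iff A H df dg f g h).2 fun ψ ψ₁ ψ₂ hC x => ?_⟩
  rw [hh]
  obtain ⟨l, l1, l2⟩ := compat_lt H hC
  obtain ⟨m, m1, m2⟩ := compat_lt H hC0
  unfold rhs
  rw [Finset.mul_sum]
  refine Finset.sum_congr rfl fun i _ => ?_
  rw [Finset.mul_sum]
  refine Finset.sum_congr rfl fun j _ => ?_
  rw [val_change A f ψ₁ ψ10, val_change A g ψ₂ ψ20]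
  have k1 : KK k (fun n => A.deg (Function.update x a i n)) S₁ (key ψ₁) (key ψ10) =
      KK k (fun n => A.deg (x n)) C₁ (key ψ) (key ψ0) := by
    have : ∀ u v e, KK k e S₁ u v = KK k e (insert a C₁) u v := by rw [H.s1]; simp
    rw [this, KK_insert _ _ _ _ _ H.a1 l1 m1]
    refine KK_congr _ _ _ _ _ _ _ (fun p hp => ?_) (fun p hp q hq => ?_) (fun p hp q hq => ?_)
    · rw [Function.update_of_ne]; rintro rfl; exact H.a1 hp
    · have := hC.c2 p hp; have := hC.c2 q hq; omega
    · have := hC0.c2 p hp; have := hC0.c2 q hq; omega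
  have k2 : KK k (fun n => A.deg (Function.update x b j n)) S₂ (key ψ₂) (key ψ20) =
      KK k (fun n => A.deg (x n)) C₂ (key ψ) (key ψ0) := by
    have : ∀ u v e, KK k e S₂ u v = KK k e (insert b C₂) u v := by rw [H.s2]; simp
    rw [this, KK_insert _ _ _ _ _ H.b2 l2 m2]
    refine KK_congr _ _ _ _ _ _ _ (fun p hp => ?_) (fun p hp q hq => ?_) (fun p hp q hq => ?_)
    · rw [Function.update_of_ne]; rintro rfl; exact H.b2 hp
    · have := hC.c4 p hp; have := hC.c4 q hq; omega
    · have := hC0.c4 p hp; have := hC0.c4 q hq; omega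
  have k0 : KK k (fun n => A.deg (x n)) D (key ψ) (key ψ0) =
      KK k (fun n => A.deg (x n)) C₁ (key ψ) (key ψ0) *
      KK k (fun n => A.deg (x n)) C₂ (key ψ) (key ψ0) := by
    have : ∀ u v e, KK k e D u v = KK k e (C₁ ∪ C₂) u v := by rw [H.sD]; simp
    rw [this, KK_union _ _ _ _ _ H.dj l m]
  rw [k0, k1, k2]
  ring

lemma comp_val [Nonempty ι] {a b : ℕ} {C₁ C₂ S₁ S₂ D : Finset ℕ} (H : SetH a b C₁ C₂ S₁ S₂ D)
    (df dg : ℤ) (f : EndS A S₁) (g : EndS A S₂)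
    (ψ : ↥D ≃ Fin D.card) (ψ₁ : ↥S₁ ≃ Fin S₁.card) (ψ₂ : ↥S₂ ≃ Fin S₂.card)
    (hC : Compat a b C₁ C₂ S₁ S₂ D (key ψ) (key ψ₁) (key ψ₂)) (x : ℕ → ι) :
    val A (compEl A a b C₁ C₂ S₁ S₂ D df dg f g) ψ x = rhs A a b C₁ df dg f g ψ₁ ψ₂ x :=
  (compProp_iff A H df dg f g _).1
    (Classical.epsilon_spec (exists_compProp A H df dg f g)) ψ ψ₁ ψ₂ hC x

lemma comp_empty [IsEmpty ι] {a b : ℕ} {C₁ C₂ S₁ S₂ D : Finset ℕ} (H : SetH a b C₁ C₂ S₁ S₂ D)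
    (df dg : ℤ) (f : EndS A S₁) (g : EndS A S₂) :
    compEl A a b C₁ C₂ S₁ S₂ D df dg f g = 0 := by
  have hs : CompProp A a b C₁ C₂ S₁ S₂ D df dg f g
      (compEl A a b C₁ C₂ S₁ S₂ D df dg f g) :=
    Classical.epsilon_spec ⟨(0 : EndS A D), by
      intro ψ ψ₁ ψ₂ _ _ _ _ _ I
      simp⟩
  refine end_ext0 A _ _ fun ψ I => ?_
  have hD : ∀ n, n ∉ D := fun n hn => isEmptyElim (I (ψ ⟨n, hn⟩))
  obtain ⟨ψ0, ψ₁, ψ₂, hC⟩ := exists_compat H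
  have := hs ψ ψ₁ ψ₂ (fun x => absurd x.2 (hD _))
    (fun s => by rw [← key_coe]; exact hC.c1 s s.2)
    (fun s hs => absurd hs (hD _))
    (fun s => by rw [← key_coe]; exact hC.c3 s s.2)
    (fun s hs => absurd hs (hD _)) I
  rw [this, LinearMap.zero_apply, Finset.univ_eq_empty, Finset.sum_empty]

lemma binv_deg (i j : ι) (h : A.binv i j ≠ 0) : A.deg j = 1 - A.deg i := by
  have hdet : IsUnit A.ω.det := (Matrix.isUnit_iff_isUnit_det _).1 A.ω_unit
  let N : Matrix ι ι k := fun i j => if A.deg i + A.deg j = 1 then A.ω⁻¹ i j else 0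
  have hN : A.ω * N = 1 := by
    have h1 := Matrix.mul_nonsing_inv A.ω hdet
    ext i l
    have h2 := congrFun (congrFun h1 i) l
    rw [Matrix.mul_apply] at h2 ⊢
    by_cases hil : A.deg i = A.deg l
    · rw [← h2]
      refine Finset.sum_congr rfl fun j _ => ?_
      by_cases hz : A.ω i j = 0
      · simp [hz]
      · have := A.ω_homog i j hz
        simp only [N]
        rw [if_pos (by omega)]
    · rw [Matrix.one_apply_ne (fun h => hil (by rw [h]))]
      refine Finset.sum_eq_zero fun j _ => ?_
      by_cases hz : A.ω i j = 0
      · simp [hz]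
      · have := A.ω_homog i j hz
        simp only [N]
        rw [if_neg (by omega), mul_zero]
  have hinv : A.ω⁻¹ = N := Matrix.inv_eq_right_inv hN
  by_contra hne
  apply h
  have hz : N i j = 0 := if_neg (by omega)
  unfold SympData.binv binvOf
  rw [hinv, hz, mul_zero]

end Aux

set_option maxHeartbeats 4000000

/-- the compositions of the twisted endomorphism operad satisfy the
twisted associativity axiom `∘_{a,b} ∘ (id ⊗ ∘_{c,d}) = − ∘_{c,d} ∘ (∘_{a,b} ⊗ id)`
as maps `End_A(C₁⊔{a},G₁) ⊗ End_A(C₂⊔{b,c},G₂) ⊗ End_A(C₃⊔{d},G₃) →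
End_A(C₁⊔C₂⊔C₃,G₁+G₂+G₃)`.  Since `∘` has degree `+1`, the Koszul evaluation of
`id ⊗ ∘_{c,d}` on `f⊗(g⊗h)` produces the sign `(−1)^{|f|}`. -/
theorem statement5 {k : Type} [Field k] {ι : Type} [Fintype ι] [DecidableEq ι]
    (A : SympData k ι) (a b c d : ℕ) (C₁ C₂ C₃ : Finset ℕ) (G₁ G₂ G₃ : ℕ)
    (hab : a ≠ b) (hcd : c ≠ d)
    (ha₁ : a ∉ C₁) (hb₂ : b ∉ C₂) (hc₂ : c ∉ C₂) (hbc : b ≠ c) (hd₃ : d ∉ C₃)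
    (hdisj₁₂ : Disjoint (insert a C₁) (insert b (insert c C₂)))
    (hdisj₁₃ : Disjoint (insert a C₁) (insert d C₃))
    (hdisj₂₃ : Disjoint (insert b (insert c C₂)) (insert d C₃))
    (hst₁ : StableCorolla (insert a C₁) G₁)
    (hst₂ : StableCorolla (insert b (insert c C₂)) G₂)
    (hst₃ : StableCorolla (insert d C₃) G₃)
    (df dg dh : ℤ)
    (f : EndS A (insert a C₁)) (g : EndS A (insert b (insert c C₂)))
    (h : EndS A (insert d C₃))
    (hf : IsHomogEnd A f df) (hg : IsHomogEnd A g dg) (hh : IsHomogEnd A h dh) :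
    msign k df •
      compEl A a b C₁ (C₂ ∪ C₃) (insert a C₁) (insert b (C₂ ∪ C₃)) (C₁ ∪ C₂ ∪ C₃)
        df (dg + dh + 1) f
        (compEl A c d (insert b C₂) C₃ (insert b (insert c C₂)) (insert d C₃)
          (insert b (C₂ ∪ C₃)) dg dh g h) =
    - compEl A c d (C₁ ∪ C₂) C₃ (insert c (C₁ ∪ C₂)) (insert d C₃) (C₁ ∪ C₂ ∪ C₃)
        (df + dg + 1) dh
        (compEl A a b C₁ (insert c C₂) (insert a C₁) (insert b (insert c C₂))
          (insert c (C₁ ∪ C₂)) df dg f g) h := by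
  simp only [Finset.disjoint_insert_left, Finset.disjoint_insert_right, Finset.mem_insert,
    not_or] at hdisj₁₂ hdisj₁₃ hdisj₂₃
  obtain ⟨⟨-, hac, ha₂⟩, hb₁, hc₁, h12⟩ : (a ≠ b ∧ a ≠ c ∧ a ∉ C₂) ∧ b ∉ C₁ ∧ c ∉ C₁ ∧ Disjoint C₁ C₂ := by
    tauto
  obtain ⟨⟨had, ha₃⟩, hd₁, h13⟩ : (a ≠ d ∧ a ∉ C₃) ∧ d ∉ C₁ ∧ Disjoint C₁ C₃ := by
    tauto
  obtain ⟨⟨hbd, hb₃⟩, hc₃, hd₂, h23⟩ : (b ≠ d ∧ b ∉ C₃) ∧ c ∉ C₃ ∧ d ∉ C₂ ∧ Disjoint C₂ C₃ := by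
    tauto
  have H1 : SetH a b C₁ (C₂ ∪ C₃) (insert a C₁) (insert b (C₂ ∪ C₃)) (C₁ ∪ C₂ ∪ C₃) :=
    ⟨rfl, rfl, by rw [Finset.union_assoc], by simp [h12, h13], by simp [*], by simp [*], by simp [*],
      by simp [*]⟩
  have H2 : SetH c d (insert b C₂) C₃ (insert b (insert c C₂)) (insert d C₃) (insert b (C₂ ∪ C₃)) :=
    ⟨Finset.insert_comm _ _ _, rfl, by rw [Finset.insert_union], by simp [h23, hb₃],
      by simp [*, hbc.symm], by simp [*], by simp [*, hbd.symm], by simp [*]⟩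
  have H3 : SetH c d (C₁ ∪ C₂) C₃ (insert c (C₁ ∪ C₂)) (insert d C₃) (C₁ ∪ C₂ ∪ C₃) :=
    ⟨rfl, rfl, rfl, by simp [h13, h23], by simp [*], by simp [*], by simp [*], by simp [*]⟩
  have H4 : SetH a b C₁ (insert c C₂) (insert a C₁) (insert b (insert c C₂)) (insert c (C₁ ∪ C₂)) :=
    ⟨rfl, rfl, by rw [Finset.union_insert], by simp [h12, hc₁], by simp [*], by simp [*], by simp [*],
      by simp [*]⟩
  rcases isEmpty_or_nonempty ι with hι | hι
  · rw [comp_empty A H1, comp_empty A H3]; simp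
  obtain ⟨e₁, i1, l1⟩ := exists_enum C₁
  obtain ⟨e₂, i2, l2⟩ := exists_enum C₂
  obtain ⟨e₃, i3, l3⟩ := exists_enum C₃
  obtain ⟨ψD, D1, D2, D3⟩ := exists_blocks (C₁ ∪ C₂ ∪ C₃) C₁ C₂ C₃ rfl h12 h13 h23
    e₁ e₂ e₃ i1 i2 i3 l1 l2 l3
  obtain ⟨ψa, a1, a2, -⟩ := exists_blocks (insert a C₁) {a} C₁ ∅ (by simp)
    (by simp [*]) (by simp) (by simp)
    (fun _ => 0) e₁ e₁ (by simp) i1 (by simp) (by simp) l1 (by simp)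
  obtain ⟨ψb, b1, b2, b3⟩ := exists_blocks (insert b (C₂ ∪ C₃)) {b} C₂ C₃ (by simp)
    (by simp [*]) (by simp [*]) h23
    (fun _ => 0) e₂ e₃ (by simp) i2 i3 (by simp) l2 l3
  obtain ⟨ψd, d1, d2, -⟩ := exists_blocks (insert d C₃) {d} C₃ ∅ (by simp)
    (by simp [*]) (by simp) (by simp)
    (fun _ => 0) e₃ e₁ (by simp) i3 (by simp) (by simp) l3 (by simp)
  obtain ⟨ψcb, x1, x2, x3⟩ := exists_blocks (insert b (insert c C₂)) {c} {b} C₂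
    (by ext; simp only [Finset.mem_insert, Finset.mem_union, Finset.mem_singleton]; tauto) (by simp [hbc.symm]) (by simp [*]) (by simp [*])
    (fun _ => 0) (fun _ => 0) e₂ (by simp) (by simp) i2 (by simp) (by simp) l2
  obtain ⟨ψbc, y1, y2, y3⟩ := exists_blocks (insert b (insert c C₂)) {b} {c} C₂
    (by ext; simp) (by simp [hbc]) (by simp [*]) (by simp [*])
    (fun _ => 0) (fun _ => 0) e₂ (by simp) (by simp) i2 (by simp) (by simp) l2
  obtain ⟨ψc, c1, c2, c3⟩ := exists_blocks (insert c (C₁ ∪ C₂)) {c} C₁ C₂ (by simp)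
    (by simp [*]) (by simp [*]) h12
    (fun _ => 0) e₁ e₂ (by simp) i1 i2 (by simp) l1 l2
  obtain ⟨ψm, m1, m2, m3⟩ := exists_blocks (insert c (C₁ ∪ C₂)) C₁ {c} C₂
    (by ext; simp only [Finset.mem_insert, Finset.mem_union, Finset.mem_singleton]; tauto) (by simp [*]) h12 (by simp [*])
    e₁ (fun _ => 0) e₂ i1 (by simp) i2 l1 (by simp) l2
  simp only [Finset.mem_singleton, forall_eq, Finset.card_singleton] at a1 a2 b1 b2 b3 d1 d2 x1 x2 x3 y1 y2 y3 c1 c2 c3 m1 m2 m3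
  have hne : ∀ {C : Finset ℕ} {p : ℕ}, p ∉ C → ∀ x ∈ C, x ≠ p := fun hp x hx h => hp (h ▸ hx)
  have cc23 : (C₂ ∪ C₃).card = C₂.card + C₃.card := Finset.card_union_of_disjoint h23
  have cc12 : (C₁ ∪ C₂).card = C₁.card + C₂.card := Finset.card_union_of_disjoint h12
  have ccb : (insert b C₂).card = C₂.card + 1 := Finset.card_insert_of_notMem hb₂
  have Q1 : Compat a b C₁ (C₂ ∪ C₃) (insert a C₁) (insert b (C₂ ∪ C₃)) (C₁ ∪ C₂ ∪ C₃)
      (key ψD) (key ψa) (key ψb) := by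
    refine ⟨?_, ?_, ?_, ?_, ?_⟩ <;> intro x hx <;>
      (try simp only [Finset.mem_insert, Finset.mem_union] at hx) <;> grind
  have Q2 : Compat c d (insert b C₂) C₃ (insert b (insert c C₂)) (insert d C₃) (insert b (C₂ ∪ C₃))
      (key ψb) (key ψcb) (key ψd) := by
    refine ⟨?_, ?_, ?_, ?_, ?_⟩ <;> intro x hx <;>
      (try simp only [Finset.mem_insert, Finset.mem_union] at hx) <;> grind
  have Q3 : Compat c d (C₁ ∪ C₂) C₃ (insert c (C₁ ∪ C₂)) (insert d C₃) (C₁ ∪ C₂ ∪ C₃)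
      (key ψD) (key ψc) (key ψd) := by
    refine ⟨?_, ?_, ?_, ?_, ?_⟩ <;> intro x hx <;>
      (try simp only [Finset.mem_insert, Finset.mem_union] at hx) <;> grind
  have Q4 : Compat a b C₁ (insert c C₂) (insert a C₁) (insert b (insert c C₂)) (insert c (C₁ ∪ C₂))
      (key ψm) (key ψa) (key ψbc) := by
    refine ⟨?_, ?_, ?_, ?_, ?_⟩ <;> intro x hx <;>
      (try simp only [Finset.mem_insert, Finset.mem_union] at hx) <;> grind
  have K1 : ∀ e : ℕ → ℤ, KK k e (insert b (insert c C₂)) (key ψcb) (key ψbc) = msign k (e c * e b) := by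
    intro e
    have := KK_move (k := k) e c {b} C₂ (key ψcb) (key ψbc) (by simp [hbc.symm]) hc₂ (by simp [hb₂])
      (by intro q hq; simp only [Finset.mem_union, Finset.mem_singleton] at hq; grind)
      (by intro q hq; simp only [Finset.mem_singleton] at hq; grind)
      (by intro q hq; grind)
      (by intro p hp q hq; simp only [Finset.mem_union, Finset.mem_singleton] at hp hq; grind)
    rw [← Finset.insert_eq, Finset.insert_comm] at this
    simpa using this
  have K2 : ∀ e : ℕ → ℤ, KK k e (insert c (C₁ ∪ C₂)) (key ψc) (key ψm) =
      msign k (e c * ∑ s ∈ C₁, e s) := by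
    intro e
    exact KK_move (k := k) e c C₁ C₂ (key ψc) (key ψm) hc₁ hc₂ h12
      (by intro q hq; simp only [Finset.mem_union] at hq; grind)
      (by intro q hq; grind)
      (by intro q hq; grind)
      (by intro p hp q hq; simp only [Finset.mem_union] at hp hq; grind)
  refine end_ext_s5 A _ _ ψD fun x => ?_
  have v1 : ∀ (r : k) (F : EndS A (C₁ ∪ C₂ ∪ C₃)), val A (r • F) ψD x = r * val A F ψD x := by
    intro r F; simp [val]
  have v2 : ∀ (F : EndS A (C₁ ∪ C₂ ∪ C₃)), val A (- F) ψD x = - val A F ψD x := by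
    intro F; simp [val]
  rw [v1, v2, comp_val A H1 _ _ _ _ ψD ψa ψb Q1, comp_val A H3 _ _ _ _ ψD ψc ψd Q3]
  unfold rhs
  simp_rw [val_change A _ ψc ψm, comp_val A H2 _ _ _ _ ψb ψcb ψd Q2, comp_val A H4 _ _ _ _ ψm ψa ψbc Q4, K2]
  unfold rhs
  simp_rw [val_change A _ ψcb ψbc, K1]
  simp only [Finset.mul_sum, Finset.sum_mul]
  rw [← Finset.sum_neg_distrib]
  simp_rw [← Finset.sum_neg_distrib]
  have hsc : ∀ (T : ι → ι → ι → ι → k), ∑ j, ∑ j', ∑ i, ∑ i', T i i' j j' =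
      ∑ i, ∑ i', ∑ j, ∑ j', T i i' j j' := by
    intro T
    calc _ = ∑ j, ∑ i, ∑ j', ∑ i', T i i' j j' := Finset.sum_congr rfl fun j _ => Finset.sum_comm
      _ = ∑ i, ∑ j, ∑ j', ∑ i', T i i' j j' := Finset.sum_comm
      _ = ∑ i, ∑ j, ∑ i', ∑ j', T i i' j j' :=
        Finset.sum_congr rfl fun i _ => Finset.sum_congr rfl fun j _ => Finset.sum_comm
      _ = _ := Finset.sum_congr rfl fun i _ => Finset.sum_comm
  refine Eq.trans ?_ (hsc _).symm
  refine Finset.sum_congr rfl fun i _ => Finset.sum_congr rfl fun i' _ =>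
    Finset.sum_congr rfl fun j _ => Finset.sum_congr rfl fun j' _ => ?_
  by_cases hz1 : A.binv i i' = 0
  · simp [hz1]
  by_cases hz2 : A.binv j j' = 0
  · simp [hz2]
  have g1 := binv_deg A i i' hz1
  have g2 := binv_deg A j j' hz2
  have F1 : val A f ψa (Function.update (Function.update x c j) a i) =
      val A f ψa (Function.update x a i) := by
    refine val_congr A _ _ fun s hs => ?_
    rw [Finset.mem_insert] at hs
    simp only [Function.update_apply]
    grind
  have F2 : val A h ψd (Function.update (Function.update x b i') d j') =
      val A h ψd (Function.update x d j') := by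
    refine val_congr A _ _ fun s hs => ?_
    rw [Finset.mem_insert] at hs
    simp only [Function.update_apply]
    grind
  have F3 : Function.update (Function.update x c j) b i' =
      Function.update (Function.update x b i') c j := Function.update_comm hbc.symm _ _ _
  have X1 : ∀ p q, p ∉ C₁ → ∑ s ∈ C₁, A.deg (Function.update x p q s) = ∑ s ∈ C₁, A.deg (x s) :=
    fun p q hp => Finset.sum_congr rfl fun s hs => by rw [Function.update_of_ne (hne hp s hs)]
  have X2 : ∀ p q, p ∉ C₂ → ∑ s ∈ C₂, A.deg (Function.update x p q s) = ∑ s ∈ C₂, A.deg (x s) :=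
    fun p q hp => Finset.sum_congr rfl fun s hs => by rw [Function.update_of_ne (hne hp s hs)]
  simp only [← Finset.mul_sum]
  rw [F1, F2, F3, Finset.sum_insert hb₂, X2 _ _ hb₂, X1 _ _ hc₁, Finset.sum_union h12]
  simp only [Function.update_self, Function.update_of_ne hbc, g1]
  generalize (∑ s ∈ C₁, A.deg (x s)) = Y1
  generalize (∑ s ∈ C₂, A.deg (x s)) = Y2
  generalize val A f ψa _ = vf
  generalize val A g ψbc _ = vg
  generalize val A h ψd _ = vh
  generalize A.binv i i' = B1
  generalize A.binv j j' = B2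
  generalize A.deg i = α
  generalize A.deg j = γ
  have hsign : msign k (df + (df + (dg + dh + 1) * (1 - α) + (dg + dh + 1 + 1 - α) * Y1) +
      (dg + dh * (1 - γ) + (dh + 1 - γ) * (1 - α + Y2)) + γ * (1 - α)) =
      msign k ((df + dg + 1 + dh * (1 - γ) + (dh + 1 - γ) * (Y1 + Y2)) + γ * Y1 +
        (df + dg * (1 - α) + (dg + 1 - α) * Y1) + 1) := by
    apply msign_congr
    push_cast
    generalize (df : ZMod 2) = z1
    generalize (dg : ZMod 2) = z2
    generalize (dh : ZMod 2) = z3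
    generalize (α : ZMod 2) = z4
    generalize (γ : ZMod 2) = z5
    generalize (Y1 : ZMod 2) = z6
    generalize (Y2 : ZMod 2) = z7
    clear * -
    revert z1 z2 z3 z4 z5 z6 z7
    decide
  rw [← msign_neg_one_mul, msign_add _ (γ * (1 - α)), msign_add _ (dg + dh * (1 - γ) + _), msign_add df _,
    msign_add _ (df + dg * (1 - α) + _), msign_add _ (γ * Y1)] at hsign
  linear_combination (B1 * B2 * vf * vg * vh) * hsign

end Paper
end
end
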